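/- Let (A_j, L_j), j = 1, 2, be compact quantum metric spaces and let (V_j, 𝓛_j) be an associated quantized metric space of (A_j, L_j): here V_j = 𝓐_j ∩ (A_j + iA_j), where 𝓐_j is the space of Lipschitz functions on the state space S(A_j) for the metric ρ_{L_j}, and 𝓛_j is the restriction to V_j of a quantized metric space structure on 𝓐_j whose first-level seminorm is the Lipschitz seminorm of ρ_{L_j}. Then dist_q(A₁, A₂) ≤ dist_NC(V₁, V₂), where dist_q is Rieffel's quantum Gromov–Hausdorff distance. -/

import Mathlib

open scoped ComplexOrder

noncomputable section

/-- The operator (ℓ² → ℓ²) norm of a complex scalar matrix. -/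
noncomputable def scalarOpNorm {m n : Type*} [Fintype m] [Fintype n] [DecidableEq n]
    (γ : Matrix m n ℂ) : ℝ :=
  ‖LinearMap.toContinuousLinearMap (Matrix.toEuclideanLin γ)‖

/-- A matrix order unit space `(V, 1)`: a complex *-vector space with a distinguished
matrix ordering (given by the graded family of positive cones) and an Archimedean
matrix order unit. -/
structure MOUS : Type 1 where
  carrier : Type
  [acg : AddCommGroup carrier]
  [mod : Module ℂ carrier]
  [sam : StarAddMonoid carrier]
  [sm : StarModule ℂ carrier]
  one : carrier
  pos : ∀ n : ℕ, Set (Matrix (Fin n) (Fin n) carrier)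
  pos_add : ∀ n, ∀ v ∈ pos n, ∀ w ∈ pos n, v + w ∈ pos n
  pos_smul : ∀ n (t : ℝ), 0 ≤ t → ∀ v ∈ pos n, (t : ℂ) • v ∈ pos n
  pos_star : ∀ n, ∀ v ∈ pos n, v.conjTranspose = v
  pos_congr : ∀ n m (γ : Matrix (Fin n) (Fin m) ℂ), ∀ v ∈ pos n,
    (Matrix.of fun i j => ∑ k, ∑ l, (star (γ k i) * γ l j) • v k l) ∈ pos m
  proper : ∀ v : Matrix (Fin 1) (Fin 1) carrier, v ∈ pos 1 → -v ∈ pos 1 → v = 0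
  unit_pos : ∀ n, Matrix.diagonal (fun _ => one) ∈ pos n
  orderUnit : ∀ v : carrier, star v = v →
    ∃ t : ℝ, 0 < t ∧
      (Matrix.of fun _ _ => (t : ℂ) • one - v : Matrix (Fin 1) (Fin 1) carrier) ∈ pos 1
  archimedean : ∀ n (v : Matrix (Fin n) (Fin n) carrier),
    (∀ t : ℝ, 0 < t → v + (t : ℂ) • Matrix.diagonal (fun _ => one) ∈ pos n) → v ∈ pos n

attribute [instance] MOUS.acg MOUS.mod MOUS.sam MOUS.sm

/-- Entrywise application of a linear map to a matrix. -/
def mapMat {V W : Type} [AddCommGroup V] [AddCommGroup W] [Module ℂ V] [Module ℂ W]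
    (φ : V →ₗ[ℂ] W) {n : ℕ} (a : Matrix (Fin n) (Fin n) V) : Matrix (Fin n) (Fin n) W :=
  Matrix.of fun i j => φ (a i j)

/-- The direct sum (block diagonal) of two matrices over a vector space. -/
def dsumMat {V : Type} [AddCommGroup V] {m n : ℕ}
    (v : Matrix (Fin m) (Fin m) V) (w : Matrix (Fin n) (Fin n) V) :
    Matrix (Fin (m + n)) (Fin (m + n)) V :=
  Matrix.reindex finSumFinEquiv finSumFinEquiv (Matrix.fromBlocks v 0 0 w)

/-- The two-sided scalar matrix product `α v β`. -/
def mmulMat {V : Type} [AddCommGroup V] [Module ℂ V] {m n : ℕ}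
    (α : Matrix (Fin n) (Fin m) ℂ) (v : Matrix (Fin m) (Fin m) V)
    (β : Matrix (Fin m) (Fin n) ℂ) : Matrix (Fin n) (Fin n) V :=
  Matrix.of fun i j => ∑ k, ∑ l, (α i k * β l j) • v k l

/-- The unit matrix `1ₙ` in `Mₙ(V)`. -/
def MOUS.unitMat (A : MOUS) (n : ℕ) : Matrix (Fin n) (Fin n) A.carrier :=
  Matrix.diagonal fun _ => A.one

/-- The matrix norm determined by the matrix order:
`‖v‖ = inf { t : [[t1, v], [v*, t1]] ≥ 0 }`. -/
def MOUS.matNorm (A : MOUS) {n : ℕ} (v : Matrix (Fin n) (Fin n) A.carrier) : ℝ :=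
  sInf {t : ℝ | (Matrix.reindex finSumFinEquiv finSumFinEquiv
    (Matrix.fromBlocks ((t : ℂ) • A.unitMat n) v v.conjTranspose ((t : ℂ) • A.unitMat n)))
      ∈ A.pos (n + n)}

/-- A matrix Lipschitz seminorm on a matrix order unit space. -/
structure IsMatrixLipschitzSeminorm (A : MOUS)
    (L : ∀ n : ℕ, Matrix (Fin n) (Fin n) A.carrier → ℝ) : Prop where
  nonneg : ∀ n v, 0 ≤ L n v
  add_le : ∀ n v w, L n (v + w) ≤ L n v + L n w
  smul_eq : ∀ n (c : ℂ) v, L n (c • v) = ‖c‖ * L n v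
  null_iff : ∀ n v, L n v = 0 ↔
    ∃ lam : Matrix (Fin n) (Fin n) ℂ, v = Matrix.of fun i j => lam i j • A.one
  dsum_eq : ∀ m n v w, L (m + n) (dsumMat v w) = max (L m v) (L n w)
  mmul_le : ∀ m n (α : Matrix (Fin n) (Fin m) ℂ) v (β : Matrix (Fin m) (Fin n) ℂ),
    L n (mmulMat α v β) ≤ scalarOpNorm α * L m v * scalarOpNorm β
  star_eq : ∀ n v, L n (Matrix.conjTranspose v) = L n v

/-- A matrix seminorm (finite matrix gauge). -/
structure IsMatrixSeminorm (A : MOUS)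
    (N : ∀ n : ℕ, Matrix (Fin n) (Fin n) A.carrier → ℝ) : Prop where
  nonneg : ∀ n v, 0 ≤ N n v
  add_le : ∀ n v w, N n (v + w) ≤ N n v + N n w
  smul_le : ∀ n (c : ℂ) v, N n (c • v) ≤ ‖c‖ * N n v
  dsum_eq : ∀ m n v w, N (m + n) (dsumMat v w) = max (N m v) (N n w)
  mmul_le : ∀ m n (α : Matrix (Fin n) (Fin m) ℂ) v (β : Matrix (Fin m) (Fin n) ℂ),
    N n (mmulMat α v β) ≤ scalarOpNorm α * N m v * scalarOpNorm β

/-- Linear maps from `V` to `Mₙ(ℂ)`; matrix states live here. -/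
abbrev MState (A : MOUS) (n : ℕ) := A.carrier →ₗ[ℂ] Matrix (Fin n) (Fin n) ℂ

/-- The matrix pairing `⟨⟨φ, a⟩⟩ = [φ(a_{ij})] ∈ M_{rn}(ℂ)`. -/
def mpair {A : MOUS} {n r : ℕ} (φ : MState A n) (a : Matrix (Fin r) (Fin r) A.carrier) :
    Matrix (Fin r × Fin n) (Fin r × Fin n) ℂ :=
  Matrix.of fun p q => φ (a p.1 q.1) p.2 q.2

/-- The `n`-th matrix state space: unital completely positive maps `V → Mₙ(ℂ)`. -/
def CS (A : MOUS) (n : ℕ) : Set (MState A n) :=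
  {φ | φ A.one = 1 ∧ ∀ r, ∀ v ∈ A.pos r, (mpair φ v).PosSemidef}

/-- The matrix metric `D_{Lₙ}` on matrix states coming from a matrix Lipschitz seminorm. -/
def Dmet (A : MOUS) (L : ∀ n : ℕ, Matrix (Fin n) (Fin n) A.carrier → ℝ) (n : ℕ)
    (φ ψ : MState A n) : ℝ :=
  sSup {x | ∃ (r : ℕ) (a : Matrix (Fin r) (Fin r) A.carrier), L r a ≤ 1 ∧
    x = scalarOpNorm (mpair φ a - mpair ψ a)}

/-- The BW (pointwise, weak-*) topology on the space of linear maps `V → Mₙ(ℂ)`. -/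
def lmTop (A : MOUS) (n : ℕ) : TopologicalSpace (MState A n) :=
  TopologicalSpace.induced (fun φ => (φ : A.carrier → Matrix (Fin n) (Fin n) ℂ)) inferInstance

/-- The BW topology on the matrix state space. -/
def BWtop (A : MOUS) (n : ℕ) : TopologicalSpace {φ : MState A n // φ ∈ CS A n} :=
  TopologicalSpace.induced Subtype.val (lmTop A n)

/-- The topology on the matrix state space defined by the matrix metric `D_L`. -/
def Dtop (A : MOUS) (L : ∀ n : ℕ, Matrix (Fin n) (Fin n) A.carrier → ℝ) (n : ℕ) :
    TopologicalSpace {φ : MState A n // φ ∈ CS A n} :=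
  TopologicalSpace.generateFrom
    {U | ∃ (φ₀ : {φ : MState A n // φ ∈ CS A n}) (ε : ℝ), 0 < ε ∧
      U = {ψ | Dmet A L n φ₀.1 ψ.1 < ε}}

/-- A matrix Lip-norm: a matrix Lipschitz seminorm for which the `D_L`-topology on
each matrix state space agrees with the BW-topology. -/
structure IsMatrixLipNorm (A : MOUS)
    (L : ∀ n : ℕ, Matrix (Fin n) (Fin n) A.carrier → ℝ)
    extends IsMatrixLipschitzSeminorm A L : Prop where
  top_eq : ∀ n, Dtop A L n = BWtop A n

/-- A unital completely positive linear map between matrix order unit spaces. -/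
structure IsUCP (A B : MOUS) (φ : A.carrier →ₗ[ℂ] B.carrier) : Prop where
  unital : φ A.one = B.one
  cp : ∀ n, ∀ v ∈ A.pos n, mapMat φ v ∈ B.pos n

/-- `L` induces `LB` via the (surjective, UCP) map `φ`:
`LB` is the corresponding family of quotient seminorms. -/
def Induces (A B : MOUS) (φ : A.carrier →ₗ[ℂ] B.carrier)
    (L : ∀ n : ℕ, Matrix (Fin n) (Fin n) A.carrier → ℝ)
    (LB : ∀ n : ℕ, Matrix (Fin n) (Fin n) B.carrier → ℝ) : Prop :=
  ∀ n (b : Matrix (Fin n) (Fin n) B.carrier),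
    LB n b = sInf {x | ∃ a, mapMat φ a = b ∧ x = L n a}

/-- The quotient seminorm of `L` via `φ`. -/
def quotSeminorm (A B : MOUS) (φ : A.carrier →ₗ[ℂ] B.carrier)
    (L : ∀ n : ℕ, Matrix (Fin n) (Fin n) A.carrier → ℝ) (n : ℕ)
    (b : Matrix (Fin n) (Fin n) B.carrier) : ℝ :=
  sInf {x | ∃ a, mapMat φ a = b ∧ x = L n a}

/-- The operator space (matrix order unit space) direct sum `V₁ ⊕ V₂`. -/
def MOUS.prod (A B : MOUS) : MOUS where
  carrier := A.carrier × B.carrier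
  one := (A.one, B.one)
  pos n := {v | (Matrix.of fun i j => (v i j).1) ∈ A.pos n ∧
    (Matrix.of fun i j => (v i j).2) ∈ B.pos n}
  pos_add := by
    rintro n v ⟨hv1, hv2⟩ w ⟨hw1, hw2⟩
    exact ⟨A.pos_add n _ hv1 _ hw1, B.pos_add n _ hv2 _ hw2⟩
  pos_smul := by
    rintro n t ht v ⟨hv1, hv2⟩
    exact ⟨A.pos_smul n t ht _ hv1, B.pos_smul n t ht _ hv2⟩
  pos_star := by
    rintro n v ⟨hv1, hv2⟩
    have h1 := A.pos_star n _ hv1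
    have h2 := B.pos_star n _ hv2
    funext i j
    exact Prod.ext (congrFun (congrFun h1 i) j) (congrFun (congrFun h2 i) j)
  pos_congr := by
    rintro n m γ v ⟨hv1, hv2⟩
    constructor
    · have h1 := A.pos_congr n m γ _ hv1
      convert h1 using 2
      funext i j
      simp [Prod.fst_sum]
    · have h2 := B.pos_congr n m γ _ hv2
      convert h2 using 2
      funext i j
      simp [Prod.snd_sum]
  proper := by
    rintro v ⟨h1, h2⟩ ⟨h3, h4⟩
    have e1 := A.proper _ h1 h3
    have e2 := B.proper _ h2 h4
    funext i j
    exact Prod.ext (congrFun (congrFun e1 i) j) (congrFun (congrFun e2 i) j)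
  unit_pos := by
    intro n
    constructor
    · convert A.unit_pos n using 2
      funext i j
      by_cases hij : i = j <;> simp [Matrix.diagonal_apply, hij]
    · convert B.unit_pos n using 2
      funext i j
      by_cases hij : i = j <;> simp [Matrix.diagonal_apply, hij]
  orderUnit := by
    rintro ⟨a, b⟩ hstar
    have ha : star a = a := congrArg Prod.fst hstar
    have hb : star b = b := congrArg Prod.snd hstar
    obtain ⟨t₁, ht₁, hp₁⟩ := A.orderUnit a ha
    obtain ⟨t₂, ht₂, hp₂⟩ := B.orderUnit b hb
    have huA : (Matrix.of fun _ _ => A.one : Matrix (Fin 1) (Fin 1) A.carrier) ∈ A.pos 1 := by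
      convert A.unit_pos 1 using 2
      funext i j
      simp [Matrix.diagonal_apply, Subsingleton.elim i j]
    have huB : (Matrix.of fun _ _ => B.one : Matrix (Fin 1) (Fin 1) B.carrier) ∈ B.pos 1 := by
      convert B.unit_pos 1 using 2
      funext i j
      simp [Matrix.diagonal_apply, Subsingleton.elim i j]
    refine ⟨t₁ + t₂, add_pos ht₁ ht₂, ?_, ?_⟩
    · have e : (Matrix.of fun _ _ => ((t₁ + t₂ : ℝ) : ℂ) • A.one - a :
          Matrix (Fin 1) (Fin 1) A.carrier)
          = (Matrix.of fun _ _ => (t₁ : ℂ) • A.one - a) +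
            (t₂ : ℂ) • (Matrix.of fun _ _ => A.one) := by
        funext i j
        show ((t₁ + t₂ : ℝ) : ℂ) • A.one - a
          = ((t₁ : ℂ) • A.one - a) + (t₂ : ℂ) • A.one
        push_cast
        rw [add_smul]
        abel
      exact e ▸ A.pos_add 1 _ hp₁ _ (A.pos_smul 1 t₂ ht₂.le _ huA)
    · have e : (Matrix.of fun _ _ => ((t₁ + t₂ : ℝ) : ℂ) • B.one - b :
          Matrix (Fin 1) (Fin 1) B.carrier)
          = (Matrix.of fun _ _ => (t₂ : ℂ) • B.one - b) +
            (t₁ : ℂ) • (Matrix.of fun _ _ => B.one) := by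
        funext i j
        show ((t₁ + t₂ : ℝ) : ℂ) • B.one - b
          = ((t₂ : ℂ) • B.one - b) + (t₁ : ℂ) • B.one
        push_cast
        rw [add_smul]
        abel
      exact e ▸ B.pos_add 1 _ hp₂ _ (B.pos_smul 1 t₁ ht₁.le _ huB)
  archimedean := by
    rintro n v h
    constructor
    · apply A.archimedean
      intro t ht
      have h1 := (h t ht).1
      have e : (Matrix.of fun i j =>
            (((v + (t : ℂ) • Matrix.diagonal fun _ =>
              ((A.one, B.one) : A.carrier × B.carrier) :
                Matrix (Fin n) (Fin n) (A.carrier × B.carrier))) i j).1)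
          = (Matrix.of fun i j => (v i j).1) +
            (t : ℂ) • Matrix.diagonal fun _ => A.one := by
        funext i j
        by_cases hij : i = j <;>
          simp [Matrix.add_apply, Matrix.smul_apply, Matrix.diagonal_apply, hij]
      rw [e] at h1
      exact h1
    · apply B.archimedean
      intro t ht
      have h2 := (h t ht).2
      have e : (Matrix.of fun i j =>
            (((v + (t : ℂ) • Matrix.diagonal fun _ =>
              ((A.one, B.one) : A.carrier × B.carrier) :
                Matrix (Fin n) (Fin n) (A.carrier × B.carrier))) i j).2)
          = (Matrix.of fun i j => (v i j).2) +
            (t : ℂ) • Matrix.diagonal fun _ => B.one := by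
        funext i j
        by_cases hij : i = j <;>
          simp [Matrix.add_apply, Matrix.smul_apply, Matrix.diagonal_apply, hij]
      rw [e] at h2
      exact h2

/-- First coordinate projection `V₁ ⊕ V₂ → V₁`. -/
def fstL (A B : MOUS) : (A.prod B).carrier →ₗ[ℂ] A.carrier :=
  LinearMap.fst ℂ A.carrier B.carrier

/-- Second coordinate projection `V₁ ⊕ V₂ → V₂`. -/
def sndL (A B : MOUS) : (A.prod B).carrier →ₗ[ℂ] B.carrier :=
  LinearMap.snd ℂ A.carrier B.carrier

/-- `M(L₁, L₂)`: the set of matrix Lip-norms on `V₁ ⊕ V₂` inducing `L₁` and `L₂`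
via the coordinate projections. -/
def MSet (A : MOUS) (LA : ∀ n : ℕ, Matrix (Fin n) (Fin n) A.carrier → ℝ)
    (B : MOUS) (LB : ∀ n : ℕ, Matrix (Fin n) (Fin n) B.carrier → ℝ) :
    Set (∀ n : ℕ, Matrix (Fin n) (Fin n) (A.prod B).carrier → ℝ) :=
  {L | IsMatrixLipNorm (A.prod B) L ∧ Induces (A.prod B) A (fstL A B) L LA ∧
    Induces (A.prod B) B (sndL A B) L LB}

/-- Hausdorff distance between two sets with respect to a distance function. -/
def hDist {X : Type} (d : X → X → ℝ) (s t : Set X) : ℝ :=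
  max (sSup ((fun x => sInf ((fun y => d x y) '' t)) '' s))
      (sSup ((fun y => sInf ((fun x => d x y) '' s)) '' t))

/-- The quantized Gromov–Hausdorff distance between two quantized metric spaces. -/
def distNC (A : MOUS) (LA : ∀ n : ℕ, Matrix (Fin n) (Fin n) A.carrier → ℝ)
    (B : MOUS) (LB : ∀ n : ℕ, Matrix (Fin n) (Fin n) B.carrier → ℝ) : ℝ :=
  sInf {x | ∃ L ∈ MSet A LA B LB, x = ⨆ n : ℕ, ((n : ℝ) ^ 2)⁻¹ *
    hDist (Dmet (A.prod B) L n)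
      ((fun φ : MState A n => φ.comp (fstL A B)) '' CS A n)
      ((fun φ : MState B n => φ.comp (sndL A B)) '' CS B n)}

/-- The diameter of a quantized metric space: the diameter of `CS₁(V)` for `D_{L₁}`. -/
def qDiam (A : MOUS) (LA : ∀ n : ℕ, Matrix (Fin n) (Fin n) A.carrier → ℝ) : ℝ :=
  sSup {x | ∃ φ ∈ CS A 1, ∃ ψ ∈ CS A 1, x = Dmet A LA 1 φ ψ}

/-- Lower semicontinuity of a family of matrix seminorms for the order-unit matrix norms. -/
def IsLSCsem (A : MOUS) (L : ∀ n : ℕ, Matrix (Fin n) (Fin n) A.carrier → ℝ) : Prop :=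
  ∀ n (a : Matrix (Fin n) (Fin n) A.carrier) (c : ℝ), c < L n a →
    ∃ δ : ℝ, 0 < δ ∧ ∀ b, A.matNorm (b - a) < δ → c < L n b


/-- An (Archimedean) order unit space `(A, e)`. -/
structure OUS : Type 1 where
  carrier : Type
  [acg : AddCommGroup carrier]
  [mod : Module ℝ carrier]
  one : carrier
  pos : Set carrier
  pos_add : ∀ v ∈ pos, ∀ w ∈ pos, v + w ∈ pos
  pos_smul : ∀ t : ℝ, 0 ≤ t → ∀ v ∈ pos, t • v ∈ pos
  proper : ∀ v, v ∈ pos → -v ∈ pos → v = 0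
  orderUnit : ∀ v, ∃ t : ℝ, 0 < t ∧ t • one - v ∈ pos
  archimedean : ∀ v, (∀ t : ℝ, 0 < t → v + t • one ∈ pos) → v ∈ pos

attribute [instance] OUS.acg OUS.mod

/-- The state space of an order unit space. -/
def States (A : OUS) : Set (A.carrier →ₗ[ℝ] ℝ) :=
  {μ | μ A.one = 1 ∧ ∀ v ∈ A.pos, 0 ≤ μ v}

/-- The metric `ρ_L(μ, ν) = sup {|μ(a) − ν(a)| : L(a) ≤ 1}` on the state space. -/
def rhoL (A : OUS) (L : A.carrier → ℝ) (μ ν : A.carrier →ₗ[ℝ] ℝ) : ℝ :=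
  sSup {x | ∃ a, L a ≤ 1 ∧ x = |μ a - ν a|}

/-- The w*-topology on the state space. -/
def wTop (A : OUS) : TopologicalSpace {μ : A.carrier →ₗ[ℝ] ℝ // μ ∈ States A} :=
  TopologicalSpace.induced (fun μ => (μ.1 : A.carrier → ℝ)) inferInstance

/-- The `ρ_L`-topology on the state space. -/
def rhoTop (A : OUS) (L : A.carrier → ℝ) :
    TopologicalSpace {μ : A.carrier →ₗ[ℝ] ℝ // μ ∈ States A} :=
  TopologicalSpace.generateFrom
    {U | ∃ (μ₀ : {μ : A.carrier →ₗ[ℝ] ℝ // μ ∈ States A}) (ε : ℝ), 0 < ε ∧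
      U = {ν | rhoL A L μ₀.1 ν.1 < ε}}

/-- A Lip-norm on an order unit space: `(A, L)` is then a compact quantum metric space
in the sense of Rieffel. -/
structure IsLipNormOUS (A : OUS) (L : A.carrier → ℝ) : Prop where
  nonneg : ∀ a, 0 ≤ L a
  add_le : ∀ a b, L (a + b) ≤ L a + L b
  smul_eq : ∀ (t : ℝ) a, L (t • a) = |t| * L a
  null_iff : ∀ a, L a = 0 ↔ ∃ t : ℝ, a = t • A.one
  top_eq : rhoTop A L = wTop A

theorem OUS.one_mem_pos (C : OUS) : C.one ∈ C.pos := by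
  obtain ⟨t₀, ht₀, hp⟩ := C.orderUnit (-C.one)
  have h1 : t₀ • C.one - -C.one = (t₀ + 1) • C.one := by module
  rw [h1] at hp
  have h2 := C.pos_smul (t₀ + 1)⁻¹ (by positivity) _ hp
  rw [smul_smul, inv_mul_cancel₀ (by positivity), one_smul] at h2
  exact h2

/-- The direct sum of two order unit spaces. -/
def OUS.prod (A B : OUS) : OUS where
  carrier := A.carrier × B.carrier
  one := (A.one, B.one)
  pos := {v | v.1 ∈ A.pos ∧ v.2 ∈ B.pos}
  pos_add := by
    rintro v ⟨h1, h2⟩ w ⟨h3, h4⟩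
    exact ⟨A.pos_add _ h1 _ h3, B.pos_add _ h2 _ h4⟩
  pos_smul := by
    rintro t ht v ⟨h1, h2⟩
    exact ⟨A.pos_smul t ht _ h1, B.pos_smul t ht _ h2⟩
  proper := by
    rintro v ⟨h1, h2⟩ ⟨h3, h4⟩
    exact Prod.ext (A.proper _ h1 h3) (B.proper _ h2 h4)
  orderUnit := by
    rintro ⟨a, b⟩
    obtain ⟨t₁, ht₁, hp₁⟩ := A.orderUnit a
    obtain ⟨t₂, ht₂, hp₂⟩ := B.orderUnit b
    refine ⟨t₁ + t₂, add_pos ht₁ ht₂, ?_, ?_⟩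
    · show (t₁ + t₂) • A.one - a ∈ A.pos
      have e : (t₁ + t₂) • A.one - a = (t₁ • A.one - a) + t₂ • A.one := by module
      rw [e]
      exact A.pos_add _ hp₁ _ (A.pos_smul t₂ ht₂.le _ A.one_mem_pos)
    · show (t₁ + t₂) • B.one - b ∈ B.pos
      have e : (t₁ + t₂) • B.one - b = (t₂ • B.one - b) + t₁ • B.one := by module
      rw [e]
      exact B.pos_add _ hp₂ _ (B.pos_smul t₁ ht₁.le _ B.one_mem_pos)
  archimedean := by
    rintro v h
    exact ⟨A.archimedean v.1 fun t ht => (h t ht).1,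
      B.archimedean v.2 fun t ht => (h t ht).2⟩

/-- `L` induces `LB` via `φ` (order unit space version). -/
def InducesOUS (A B : OUS) (φ : A.carrier →ₗ[ℝ] B.carrier)
    (L : A.carrier → ℝ) (LB : B.carrier → ℝ) : Prop :=
  ∀ b, LB b = sInf {x | ∃ a, φ a = b ∧ x = L a}

/-- Rieffel's quantum Gromov–Hausdorff distance between compact quantum metric spaces. -/
def distq (A : OUS) (LA : A.carrier → ℝ) (B : OUS) (LB : B.carrier → ℝ) : ℝ :=
  sInf {x | ∃ L : (A.prod B).carrier → ℝ, IsLipNormOUS (A.prod B) L ∧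
    InducesOUS (A.prod B) A (LinearMap.fst ℝ A.carrier B.carrier) L LA ∧
    InducesOUS (A.prod B) B (LinearMap.snd ℝ A.carrier B.carrier) L LB ∧
    x = hDist (rhoL (A.prod B) L)
      ((fun μ : A.carrier →ₗ[ℝ] ℝ =>
        μ.comp (LinearMap.fst ℝ A.carrier B.carrier)) '' States A)
      ((fun μ : B.carrier →ₗ[ℝ] ℝ =>
        μ.comp (LinearMap.snd ℝ A.carrier B.carrier)) '' States B)}

/-- The Lipschitz seminorm on `A` of the function `â` on the state space `(S(A), ρ_L)`:
the least Lipschitz constant. -/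
def lipS (A : OUS) (L : A.carrier → ℝ) (a : A.carrier) : ℝ :=
  sInf {c : ℝ | 0 ≤ c ∧ ∀ μ ∈ States A, ∀ ν ∈ States A,
    |μ a - ν a| ≤ c * rhoL A L μ ν}

/-- `(V, LV)` is an associated quantized metric space of the compact quantum metric space
`(A, L)`:  `V = 𝓐 ∩ (A + iA)` inside the space `𝓐` of Lipschitz functions on
`(S(A), ρ_L)`, with a quantized metric space structure whose first-level seminorm is the
Lipschitz seminorm of `ρ_L`.  The embedding `ι : A → V` is unital, real-linear,
star-fixed, and identifies: the self-adjoint part of `V` with (Lipschitz elements of)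
`A`, `V = ι(A) + i·ι(A)`, the matrix state space `CS₁(V)` with `S(A)` by restriction,
and `LV` at level one with the Lipschitz seminorm of `ρ_L`. -/
structure IsAssociatedQMS (A : OUS) (LA : A.carrier → ℝ) (Vq : MOUS)
    (LV : ∀ n : ℕ, Matrix (Fin n) (Fin n) Vq.carrier → ℝ)
    (ι : A.carrier → Vq.carrier) : Prop where
  lip : IsMatrixLipNorm Vq LV
  add_hom : ∀ a b, ι (a + b) = ι a + ι b
  smul_hom : ∀ (t : ℝ) a, ι (t • a) = (t : ℂ) • ι a
  unital : ι A.one = Vq.one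
  selfadj : ∀ a, star (ι a) = ι a
  inj : Function.Injective ι
  spans : ∀ v : Vq.carrier, ∃ a b, v = ι a + Complex.I • ι b
  lip_eq : ∀ a, LV 1 (Matrix.of fun _ _ => ι a) = lipS A LA a
  states_to : ∀ φ ∈ CS Vq 1, ∃ μ ∈ States A,
    ∀ a, (μ : A.carrier →ₗ[ℝ] ℝ) a = (φ (ι a) 0 0).re
  states_surj : ∀ μ ∈ States A, ∃ φ ∈ CS Vq 1,
    ∀ a, (φ (ι a) 0 0).re = (μ : A.carrier →ₗ[ℝ] ℝ) a

/-! ### Positive functionals and states -/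

section PositiveFunctionals

variable {𝕜 E : Type*} [RCLike 𝕜] [AddCommGroup E] [Module 𝕜 E]

/-- A linear functional taking nonnegative real values on `P`. -/
def IsPosFunctional (P : Set E) (f : E →ₗ[𝕜] 𝕜) : Prop :=
  ∀ v ∈ P, 0 ≤ RCLike.re (f v) ∧ RCLike.im (f v) = 0

variable (𝕜) in
/-- The functionals that are positive on `P` and normalized at `e`. -/
def posStates (e : E) (P : Set E) : Set (E →ₗ[𝕜] 𝕜) :=
  {f | f e = 1 ∧ IsPosFunctional P f}

variable (𝕜) in
/-- The element `e` is positive and bounds every element uniformly over the positive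
functionals. -/
structure IsOrderBounding (e : E) (P : Set E) : Prop where
  zero_mem : 0 ∈ P
  one_mem : e ∈ P
  bound : ∀ a, ∃ R : ℝ, ∀ f : E →ₗ[𝕜] 𝕜, IsPosFunctional P f → ‖f a‖ ≤ R * RCLike.re (f e)

variable {e : E} {P : Set E}

theorem IsOrderBounding.norm_le (H : IsOrderBounding 𝕜 e P) {a : E} {ε : ℝ}
    (ha : ∀ φ ∈ posStates 𝕜 e P, ‖φ a‖ ≤ ε) {f : E →ₗ[𝕜] 𝕜} (hf : IsPosFunctional P f) :
    ‖f a‖ ≤ ε * RCLike.re (f e) := by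
  obtain ⟨h0, him⟩ := hf e H.one_mem
  rcases h0.eq_or_lt with h | h
  · obtain ⟨R, hR⟩ := H.bound a
    simpa [← h] using hR f hf
  · set t := RCLike.re (f e) with ht
    have hfe : f e = (t : 𝕜) := by
      apply RCLike.ext <;> simp [ht, him]
    have hg : ((t⁻¹ : ℝ) : 𝕜) • f ∈ posStates 𝕜 e P := by
      refine ⟨?_, fun v hv => ?_⟩
      · rw [LinearMap.smul_apply, hfe, smul_eq_mul, ← RCLike.ofReal_mul, inv_mul_cancel₀ h.ne',
          RCLike.ofReal_one]
      · obtain ⟨h1, h2⟩ := hf v hv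
        rw [LinearMap.smul_apply, smul_eq_mul, RCLike.re_ofReal_mul, RCLike.im_ofReal_mul, h2]
        exact ⟨mul_nonneg (inv_nonneg.2 h.le) h1, mul_zero _⟩
    have := ha _ hg
    rw [LinearMap.smul_apply, norm_smul, RCLike.norm_ofReal, abs_of_pos (inv_pos.2 h),
      inv_mul_le_iff₀ h] at this
    linarith

theorem IsOrderBounding.exists_norm_le (H : IsOrderBounding 𝕜 e P) (a : E) :
    ∃ R : ℝ, 0 ≤ R ∧ ∀ φ ∈ posStates 𝕜 e P, ‖φ a‖ ≤ R := by
  obtain ⟨R, hR⟩ := H.bound a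
  refine ⟨max R 0, le_max_right _ _, fun φ hφ => ?_⟩
  have := hR φ hφ.2
  rw [hφ.1, RCLike.one_re, mul_one] at this
  exact this.trans (le_max_left _ _)

theorem posStates_segment_mem {φ ψ : E →ₗ[𝕜] 𝕜} (hφ : φ ∈ posStates 𝕜 e P)
    (hψ : ψ ∈ posStates 𝕜 e P) {t : ℝ} (h0 : 0 ≤ t) (h1 : t ≤ 1) :
    φ + (t : 𝕜) • (ψ - φ) ∈ posStates 𝕜 e P := by
  refine ⟨by simp [hφ.1, hψ.1], fun v hv => ?_⟩
  obtain ⟨a1, a2⟩ := hφ.2 v hv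
  obtain ⟨b1, b2⟩ := hψ.2 v hv
  simp only [LinearMap.add_apply, LinearMap.smul_apply, LinearMap.sub_apply, smul_eq_mul,
    map_add, RCLike.re_ofReal_mul, RCLike.im_ofReal_mul, map_sub, a2, b2]
  refine ⟨?_, by simp⟩
  nlinarith [mul_nonneg h0 b1, mul_nonneg (sub_nonneg.2 h1) a1]

theorem IsOrderBounding.isCompact_coe_image (H : IsOrderBounding 𝕜 e P) :
    IsCompact ((fun (φ : E →ₗ[𝕜] 𝕜) (v : E) => φ v) '' posStates 𝕜 e P) := by
  choose R _ hR using H.exists_norm_le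
  have hK : IsCompact (Set.univ.pi fun v : E => Metric.closedBall (0 : 𝕜) (R v)) :=
    isCompact_univ_pi fun v => isCompact_closedBall _ _
  refine hK.of_isClosed_subset ?_ ?_
  · have hset : ((fun (φ : E →ₗ[𝕜] 𝕜) (v : E) => φ v) '' posStates 𝕜 e P) =
        {f : E → 𝕜 | (∀ v w, f (v + w) = f v + f w) ∧ (∀ (c : 𝕜) v, f (c • v) = c • f v) ∧
          f e = 1 ∧ ∀ v ∈ P, 0 ≤ RCLike.re (f v) ∧ RCLike.im (f v) = 0} := by
      ext f
      constructor
      · rintro ⟨φ, hφ, rfl⟩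
        exact ⟨map_add φ, map_smul φ, hφ.1, hφ.2⟩
      · rintro ⟨h1, h2, h3, h4⟩
        exact ⟨{ toFun := f, map_add' := h1, map_smul' := h2 }, ⟨h3, h4⟩, rfl⟩
    rw [hset]
    simp only [Set.ofPred_and, Set.ofPred_forall]
    refine IsClosed.inter ?_ (IsClosed.inter ?_ (IsClosed.inter ?_ ?_))
    · exact isClosed_iInter fun v => isClosed_iInter fun w =>
        isClosed_eq (continuous_apply _) ((continuous_apply v).add (continuous_apply w))
    · exact isClosed_iInter fun c => isClosed_iInter fun v =>
        isClosed_eq (continuous_apply _) ((continuous_apply _).const_smul c)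
    · exact isClosed_eq (continuous_apply _) continuous_const
    · refine isClosed_iInter fun v => isClosed_iInter fun _ => IsClosed.inter ?_ ?_
      · exact isClosed_le continuous_const (RCLike.continuous_re.comp (continuous_apply _))
      · exact isClosed_eq (RCLike.continuous_im.comp (continuous_apply _)) continuous_const
  · rintro _ ⟨φ, hφ, rfl⟩ v -
    simpa using hR v φ hφ

end PositiveFunctionals

/-! ### Total boundedness of the Lipschitz ball modulo scalars -/

section TotalBoundedness

variable {𝕜 E : Type*} [RCLike 𝕜] [AddCommGroup E] [Module 𝕜 E]

/-- The set `B` is totally bounded modulo scalars, uniformly over the functionals in `S`. -/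
def TotallyBoundedModScalars (S : Set (E →ₗ[𝕜] 𝕜)) (B : Set E) : Prop :=
  ∀ ε : ℝ, 0 < ε → ∃ F : Set E, F.Finite ∧
    ∀ b ∈ B, ∃ f ∈ F, ∃ c : 𝕜, ∀ φ ∈ S, ‖φ b - φ f - c‖ ≤ ε

theorem TotallyBoundedModScalars.mono {S : Set (E →ₗ[𝕜] 𝕜)} {B B' : Set E}
    (h : TotallyBoundedModScalars S B) (hB : B' ⊆ B) : TotallyBoundedModScalars S B' :=
  fun ε hε => let ⟨F, hF, h'⟩ := h ε hε; ⟨F, hF, fun b hb => h' b (hB hb)⟩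

variable {e : E} {P : Set E} {X : Type*}

/-- The values whose supremum defines the distance of `x` and `y`. -/
def diffValues (ev : X → E →ₗ[𝕜] 𝕜) (B : Set E) (x y : X) : Set ℝ :=
  {r | ∃ a ∈ B, r = ‖ev x a - ev y a‖}

theorem diffValues_comm (ev : X → E →ₗ[𝕜] 𝕜) (B : Set E) (x y : X) :
    diffValues ev B x y = diffValues ev B y x := by
  simp only [diffValues, norm_sub_rev]

theorem bddAbove_diffValues_trans {ev : X → E →ₗ[𝕜] 𝕜} {B : Set E} {x y z : X}
    (h₁ : BddAbove (diffValues ev B x y)) (h₂ : BddAbove (diffValues ev B y z)) :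
    BddAbove (diffValues ev B x z) := by
  obtain ⟨C₁, hC₁⟩ := h₁
  obtain ⟨C₂, hC₂⟩ := h₂
  refine ⟨C₁ + C₂, ?_⟩
  rintro _ ⟨a, ha, rfl⟩
  exact (norm_sub_le_norm_sub_add_norm_sub _ (ev y a) _).trans
    (add_le_add (hC₁ ⟨a, ha, rfl⟩) (hC₂ ⟨a, ha, rfl⟩))

/-- If the distance balls generate the topology of pointwise convergence then all distances are
finite: otherwise that topology would be coarser than the cofinite topology on a segment. -/
theorem bddAbove_diffValues {ev : X → E →ₗ[𝕜] 𝕜}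
    (hX : Set.range ev = posStates 𝕜 e P) {B : Set E}
    (htop : TopologicalSpace.generateFrom
        {U | ∃ (x₀ : X) (ε : ℝ), 0 < ε ∧ U = {y | sSup (diffValues ev B x₀ y) < ε}} =
      TopologicalSpace.induced (fun x v => ev x v) inferInstance) (x y : X) :
    BddAbove (diffValues ev B x y) := by
  by_contra hxy
  have hne : ∃ a ∈ B, ev x a ≠ ev y a := by
    by_contra! h
    refine hxy ⟨0, ?_⟩
    rintro _ ⟨a, ha, rfl⟩
    simp [h a ha]
  obtain ⟨a, -, ha⟩ := hne
  let τ : CofiniteTopology (Set.Icc (0 : ℝ) 1) → ℝ := fun t =>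
    ((CofiniteTopology.of.symm t : Set.Icc (0 : ℝ) 1) : ℝ)
  have hτ : Function.Injective τ :=
    Subtype.val_injective.comp CofiniteTopology.of.symm.injective
  have hseg : ∀ t, ∃ z : X, ev z = ev x + (τ t : 𝕜) • (ev y - ev x) := by
    intro t
    have : ev x + (τ t : 𝕜) • (ev y - ev x) ∈ Set.range ev := by
      rw [hX]
      exact posStates_segment_mem (hX ▸ ⟨x, rfl⟩) (hX ▸ ⟨y, rfl⟩)
        (CofiniteTopology.of.symm t).2.1 (CofiniteTopology.of.symm t).2.2
    exact this
  choose c hc using hseg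
  have hinf : ∀ s t, s ≠ t → ¬ BddAbove (diffValues ev B (c s) (c t)) := by
    rintro s t hst ⟨C, hC⟩
    have hpos : 0 < |τ s - τ t| := abs_pos.2 (sub_ne_zero.2 fun h => hst (hτ h))
    refine hxy ⟨C / |τ s - τ t|, ?_⟩
    rintro _ ⟨b, hb, rfl⟩
    have h1 := hC ⟨b, hb, rfl⟩
    have h2 : ev (c s) b - ev (c t) b = ((τ s - τ t : ℝ) : 𝕜) * (ev y b - ev x b) := by
      simp only [hc, LinearMap.add_apply, LinearMap.smul_apply, LinearMap.sub_apply, smul_eq_mul]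
      push_cast
      ring
    rw [h2, norm_mul, RCLike.norm_ofReal, norm_sub_rev] at h1
    rw [le_div_iff₀ hpos]
    linarith
  have hcont : @Continuous _ X _
      (TopologicalSpace.induced (fun x v => ev x v) inferInstance) c := by
    rw [← htop]
    refine continuous_generateFrom_iff.2 ?_
    rintro _ ⟨z, ε, hε, rfl⟩
    rw [CofiniteTopology.isOpen_iff]
    intro _
    refine Set.Subsingleton.finite fun s hs t ht => ?_
    have key : ∀ u, u ∈ (c ⁻¹' {y | sSup (diffValues ev B z y) < ε})ᶜ →
        BddAbove (diffValues ev B z (c u)) := by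
      intro u hu
      by_contra hb
      refine hu ?_
      change sSup _ < ε
      rwa [Real.sSup_of_not_bddAbove hb]
    by_contra hst
    refine hinf s t hst (bddAbove_diffValues_trans (y := z) ?_ (key t ht))
    rw [diffValues_comm]
    exact key s hs
  have hval : Continuous fun t => ev (c t) a := by
    have h1 := @Continuous.comp _ _ _ _ (TopologicalSpace.induced (fun x v => ev x v)
      inferInstance) _ _ _ (continuous_induced_dom (f := fun x (v : E) => ev x v)) hcont
    exact (continuous_apply a).comp h1
  have hr : 0 < ‖ev y a - ev x a‖ := norm_pos_iff.2 (sub_ne_zero.2 (Ne.symm ha))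
  have hfin : ∀ b : 𝕜, (∃ t, ev (c t) a = b) →
      {t | ev (c t) a ∈ Metric.ball b (‖ev y a - ev x a‖ / 2)}ᶜ.Finite := by
    rintro b ⟨t, ht⟩
    refine CofiniteTopology.isOpen_iff.1 (Metric.isOpen_ball.preimage hval) ⟨t, ?_⟩
    change ev (c t) a ∈ Metric.ball b _
    rw [ht]
    exact Metric.mem_ball_self (half_pos hr)
  have f0 := hfin (ev x a) ⟨CofiniteTopology.of ⟨0, by simp⟩, by simp [hc, τ]⟩
  have f1 := hfin (ev y a) ⟨CofiniteTopology.of ⟨1, by simp⟩, by simp [hc, τ]⟩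
  have huniv := f0.union f1
  rw [← Set.compl_inter] at huniv
  have hempty : {t | ev (c t) a ∈ Metric.ball (ev x a) (‖ev y a - ev x a‖ / 2)} ∩
      {t | ev (c t) a ∈ Metric.ball (ev y a) (‖ev y a - ev x a‖ / 2)} = ∅ := by
    ext t
    simp only [Set.mem_inter_iff, Set.mem_ofPred_eq, Metric.mem_ball, Set.mem_empty_iff_false,
      iff_false, not_and, not_lt]
    intro h
    have := dist_triangle_left (ev y a) (ev x a) (ev (c t) a)
    rw [dist_eq_norm (ev y a)] at this
    linarith
  rw [hempty, Set.compl_empty] at huniv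
  have : Infinite (Set.Icc (0 : ℝ) 1) := (Set.Icc_infinite zero_lt_one).to_subtype
  have := Infinite.of_injective _ (CofiniteTopology.of (X := Set.Icc (0 : ℝ) 1)).injective
  exact Set.infinite_univ huniv

/-- If the distance balls generate the topology of pointwise convergence then the unit ball is
totally bounded modulo scalars. -/
theorem totallyBoundedModScalars_of_generateFrom_eq {ev : X → E →ₗ[𝕜] 𝕜}
    (hX : Set.range ev = posStates 𝕜 e P) (H : IsOrderBounding 𝕜 e P) {B : Set E}
    (htop : TopologicalSpace.generateFrom
        {U | ∃ (x₀ : X) (ε : ℝ), 0 < ε ∧ U = {y | sSup (diffValues ev B x₀ y) < ε}} =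
      TopologicalSpace.induced (fun x v => ev x v) inferInstance) :
    TotallyBoundedModScalars (posStates 𝕜 e P) B := by
  intro ε hε
  rcases isEmpty_or_nonempty X with hemp | ⟨⟨x₀⟩⟩
  · refine ⟨{0}, Set.finite_singleton _, fun b _ => ⟨0, rfl, 0, fun φ hφ => ?_⟩⟩
    rw [← hX] at hφ
    exact hemp.elim hφ.choose
  have hbdd := bddAbove_diffValues hX htop
  let _ : TopologicalSpace X := TopologicalSpace.induced (fun x (v : E) => ev x v) inferInstance
  have hcomp : IsCompact (Set.univ : Set X) := by
    rw [Topology.IsInducing.isCompact_iff (f := fun x (v : E) => ev x v) ⟨rfl⟩]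
    have := H.isCompact_coe_image
    rw [← hX, ← Set.range_comp] at this
    rwa [Set.image_univ]
  have hopen : ∀ x : X, IsOpen {y | sSup (diffValues ev B x y) < ε / 3} := by
    intro x
    change @IsOpen X (TopologicalSpace.induced (fun x (v : E) => ev x v) inferInstance) _
    rw [← htop]
    exact TopologicalSpace.isOpen_generateFrom_of_mem ⟨x, ε / 3, by positivity, rfl⟩
  have hself : ∀ x : X, sSup (diffValues ev B x x) < ε / 3 := by
    intro x
    refine (Real.sSup_le ?_ le_rfl).trans_lt (by positivity)
    rintro _ ⟨a, -, rfl⟩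
    simp
  obtain ⟨T, hT⟩ := hcomp.elim_finite_subcover
    (fun x => {y | sSup (diffValues ev B x y) < ε / 3}) hopen
    (fun x _ => Set.mem_iUnion.2 ⟨x, hself x⟩)
  let g : E → (T → 𝕜) := fun b x => ev x b - ev x₀ b
  have hgb : Bornology.IsBounded (g '' B) := by
    refine (Bornology.forall_isBounded_image_eval_iff).1 fun x => ?_
    obtain ⟨C, hC⟩ := hbdd x x₀
    refine isBounded_iff_forall_norm_le.2 ⟨C, ?_⟩
    rintro _ ⟨_, ⟨b, hb, rfl⟩, rfl⟩
    exact hC ⟨b, hb, rfl⟩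
  obtain ⟨t, htB, htf, hcov⟩ := Metric.finite_approx_of_totallyBounded
    (hgb.isCompact_closure.totallyBounded.subset subset_closure) (ε / 3) (by positivity)
  refine ⟨Function.invFunOn g B '' t, htf.image _, fun b hb => ?_⟩
  obtain ⟨w, hw, hbw⟩ := Set.mem_iUnion₂.1 (hcov ⟨b, hb, rfl⟩)
  have hfB := Function.invFunOn_mem (htB hw)
  have hfg := Function.invFunOn_eq (htB hw)
  set f := Function.invFunOn g B w
  refine ⟨f, ⟨w, hw, rfl⟩, ev x₀ b - ev x₀ f, fun φ hφ => ?_⟩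
  rw [← hX] at hφ
  obtain ⟨y, rfl⟩ := hφ
  obtain ⟨x, hxT, hxy⟩ := Set.mem_iUnion₂.1 (hT (Set.mem_univ y))
  change sSup (diffValues ev B x y) < ε / 3 at hxy
  have h1 : ‖ev x b - ev y b‖ ≤ ε / 3 :=
    (le_csSup (hbdd x y) ⟨b, hb, rfl⟩).trans hxy.le
  have h2 : ‖ev x f - ev y f‖ ≤ ε / 3 :=
    (le_csSup (hbdd x y) ⟨f, hfB, rfl⟩).trans hxy.le
  have h3 : ‖(ev x b - ev x₀ b) - (ev x f - ev x₀ f)‖ ≤ ε / 3 := by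
    rw [← hfg, Metric.mem_ball, dist_eq_norm] at hbw
    exact (norm_le_pi_norm (g b - g f) ⟨x, hxT⟩).trans hbw.le
  have hsplit : ev y b - ev y f - (ev x₀ b - ev x₀ f) =
      ((ev x b - ev x₀ b) - (ev x f - ev x₀ f)) - (ev x b - ev y b) + (ev x f - ev y f) := by
    ring
  rw [hsplit]
  refine (norm_add_le _ _).trans ?_
  have := norm_sub_le ((ev x b - ev x₀ b) - (ev x f - ev x₀ f)) (ev x b - ev y b)
  linarith

/-- Total boundedness of the Lipschitz balls passes to direct sums. -/
theorem TotallyBoundedModScalars.prod {E₁ E₂ : Type*} [AddCommGroup E₁] [Module 𝕜 E₁]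
    [AddCommGroup E₂] [Module 𝕜 E₂] {e₁ : E₁} {P₁ : Set E₁} {e₂ : E₂} {P₂ : Set E₂}
    (H₁ : IsOrderBounding 𝕜 e₁ P₁) (H₂ : IsOrderBounding 𝕜 e₂ P₂)
    {B₁ : Set E₁} {B₂ : Set E₂}
    (h₁ : TotallyBoundedModScalars (posStates 𝕜 e₁ P₁) B₁)
    (h₂ : TotallyBoundedModScalars (posStates 𝕜 e₂ P₂) B₂)
    {φ₀ : E₁ →ₗ[𝕜] 𝕜} (hφ₀ : φ₀ ∈ posStates 𝕜 e₁ P₁)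
    {ψ₀ : E₂ →ₗ[𝕜] 𝕜} (hψ₀ : ψ₀ ∈ posStates 𝕜 e₂ P₂) (R : ℝ) :
    TotallyBoundedModScalars (posStates 𝕜 (e₁, e₂) (P₁ ×ˢ P₂))
      {p | p.1 ∈ B₁ ∧ p.2 ∈ B₂ ∧ ‖φ₀ p.1 - ψ₀ p.2‖ ≤ R} := by
  intro ε hε
  obtain ⟨F₁, hF₁, hB₁⟩ := h₁ (ε / 2) (by positivity)
  obtain ⟨F₂, hF₂, hB₂⟩ := h₂ (ε / 2) (by positivity)
  obtain ⟨M, hM⟩ := ((hF₁.prod hF₂).image fun p => ‖φ₀ p.1 - ψ₀ p.2‖).bddAbove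
  obtain ⟨G, -, hG, hcov⟩ := Metric.finite_approx_of_totallyBounded
    (isCompact_closedBall (0 : 𝕜) (R + M + ε)).totallyBounded (ε / 2) (by positivity)
  refine ⟨(fun q : (E₁ × E₂) × 𝕜 => (q.1.1, q.1.2 + q.2 • e₂)) '' ((F₁ ×ˢ F₂) ×ˢ G),
    ((hF₁.prod hF₂).prod hG).image _, ?_⟩
  rintro ⟨a, b⟩ ⟨ha, hb, hab⟩
  obtain ⟨f₁, hf₁, c₁, hc₁⟩ := hB₁ a ha
  obtain ⟨f₂, hf₂, c₂, hc₂⟩ := hB₂ b hb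
  have hd : c₂ - c₁ ∈ Metric.closedBall (0 : 𝕜) (R + M + ε) := by
    rw [mem_closedBall_zero_iff]
    have e1 := hc₁ φ₀ hφ₀
    have e2 := hc₂ ψ₀ hψ₀
    have e3 : ‖φ₀ f₁ - ψ₀ f₂‖ ≤ M := hM ⟨(f₁, f₂), ⟨hf₁, hf₂⟩, rfl⟩
    have e4 : c₂ - c₁ = ((φ₀ a - φ₀ f₁ - c₁) - (ψ₀ b - ψ₀ f₂ - c₂)) -
        ((φ₀ a - ψ₀ b) - (φ₀ f₁ - ψ₀ f₂)) := by ring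
    rw [e4]
    have n1 := norm_sub_le ((φ₀ a - φ₀ f₁ - c₁) - (ψ₀ b - ψ₀ f₂ - c₂))
      ((φ₀ a - ψ₀ b) - (φ₀ f₁ - ψ₀ f₂))
    have n2 := norm_sub_le (φ₀ a - φ₀ f₁ - c₁) (ψ₀ b - ψ₀ f₂ - c₂)
    have n3 := norm_sub_le (φ₀ a - ψ₀ b) (φ₀ f₁ - ψ₀ f₂)
    dsimp only at hab
    linarith
  obtain ⟨g, hg, hgd⟩ := Set.mem_iUnion₂.1 (hcov hd)
  rw [Metric.mem_ball, dist_eq_norm] at hgd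
  refine ⟨_, ⟨((f₁, f₂), g), ⟨⟨hf₁, hf₂⟩, hg⟩, rfl⟩, c₁, fun Φ hΦ => ?_⟩
  have hpos₁ : IsPosFunctional P₁ (Φ ∘ₗ LinearMap.inl 𝕜 E₁ E₂) :=
    fun v hv => hΦ.2 (v, 0) ⟨hv, H₂.zero_mem⟩
  have hpos₂ : IsPosFunctional P₂ (Φ ∘ₗ LinearMap.inr 𝕜 E₁ E₂) :=
    fun v hv => hΦ.2 (0, v) ⟨H₁.zero_mem, hv⟩
  have k1 := H₁.norm_le (a := a - f₁ - c₁ • e₁) (ε := ε / 2)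
    (fun φ hφ => by simpa [hφ.1] using hc₁ φ hφ) hpos₁
  have k2 := H₂.norm_le (a := b - f₂ - c₂ • e₂) (ε := ε / 2)
    (fun φ hφ => by simpa [hφ.1] using hc₂ φ hφ) hpos₂
  have k3 := H₂.norm_le (a := e₂) (ε := 1) (fun φ hφ => by simp [hφ.1]) hpos₂
  have hone : Φ (e₁, 0) + Φ (0, e₂) = 1 := by
    rw [← map_add, Prod.mk_add_mk, add_zero, zero_add, hΦ.1]
  have hre := congrArg RCLike.re hone
  have hre₁ := (hpos₁ e₁ H₁.one_mem).1
  simp only [LinearMap.comp_apply, LinearMap.inl_apply, LinearMap.inr_apply, map_add,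
    RCLike.one_re] at k1 k2 k3 hre hre₁
  have hsplit : Φ (a, b) - Φ (f₁, f₂ + g • e₂) - c₁ =
      Φ (a - f₁ - c₁ • e₁, 0) + Φ (0, b - f₂ - c₂ • e₂) + (c₂ - c₁ - g) * Φ (0, e₂) := by
    have s1 : (a - f₁ - c₁ • e₁, (0 : E₂)) = (a, 0) - (f₁, 0) - c₁ • (e₁, 0) := by simp
    have s2 : ((0 : E₁), b - f₂ - c₂ • e₂) = (0, b) - (0, f₂) - c₂ • (0, e₂) := by simp
    have s3 : (a, b) = (a, (0 : E₂)) + ((0 : E₁), b) := by simp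
    have s4 : (f₁, f₂ + g • e₂) = (f₁, (0 : E₂)) + ((0 : E₁), f₂) + g • ((0 : E₁), e₂) := by simp
    rw [s1, s2, s3, s4]
    simp only [map_add, map_sub, map_smul, smul_eq_mul]
    linear_combination c₁ * hone
  rw [hsplit]
  have n1 := norm_add_le (Φ (a - f₁ - c₁ • e₁, 0) + Φ (0, b - f₂ - c₂ • e₂))
    ((c₂ - c₁ - g) * Φ (0, e₂))
  have n2 := norm_add_le (Φ (a - f₁ - c₁ • e₁, 0)) (Φ (0, b - f₂ - c₂ • e₂))
  have n3 : ‖(c₂ - c₁ - g) * Φ (0, e₂)‖ ≤ ε / 2 * 1 := by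
    rw [norm_mul]
    exact mul_le_mul hgd.le (by linarith) (norm_nonneg _) (by positivity)
  nlinarith

/-- If the distance is finite, dominates all evaluations and is small on pointwise
neighbourhoods then its balls generate the topology of pointwise convergence. -/
theorem generateFrom_balls_eq_induced {X V G : Type*} [SeminormedAddCommGroup G]
    (ev : X → V → G) (d : X → X → ℝ) (d_self : ∀ x, d x x = 0)
    (d_nonneg : ∀ x y, 0 ≤ d x y)
    (d_tri : ∀ x y z, d x z ≤ d x y + d y z)
    (hev : ∀ v, ∃ C, ∀ x y, ‖ev x v - ev y v‖ ≤ C * d x y)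
    (hsmall : ∀ ε > 0, ∃ F : Set V, F.Finite ∧ ∃ δ > 0, ∀ x y,
      (∀ f ∈ F, ‖ev x f - ev y f‖ < δ) → d x y < ε) :
    TopologicalSpace.generateFrom
        {U | ∃ (x₀ : X) (ε : ℝ), 0 < ε ∧ U = {y | d x₀ y < ε}} =
      TopologicalSpace.induced ev inferInstance := by
  apply le_antisymm
  · rw [← continuous_iff_le_induced]
    refine @continuous_pi _ _ _ (_) _ _ fun v => ?_
    let _ : TopologicalSpace X := TopologicalSpace.generateFrom
        {U | ∃ (x₀ : X) (ε : ℝ), 0 < ε ∧ U = {y | d x₀ y < ε}}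
    refine Metric.continuous_iff'.2 fun x ε hε => ?_
    obtain ⟨C, hC⟩ := hev v
    have hd : ∀ x y, ‖ev x v - ev y v‖ ≤ (|C| + 1) * d x y := fun x y =>
      (hC x y).trans (mul_le_mul_of_nonneg_right (by linarith [le_abs_self C]) (d_nonneg x y))
    have hop : IsOpen {y | d x y < ε / (|C| + 1)} :=
      TopologicalSpace.isOpen_generateFrom_of_mem ⟨x, _, by positivity, rfl⟩
    filter_upwards [hop.mem_nhds (show d x x < ε / (|C| + 1) by rw [d_self]; positivity)]
      with y hy
    rw [dist_comm, dist_eq_norm]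
    refine (hd x y).trans_lt ?_
    rw [mul_comm]
    exact (lt_div_iff₀ (by positivity)).1 hy
  · refine le_generateFrom ?_
    rintro _ ⟨x₀, ε, -, rfl⟩
    let _ : TopologicalSpace X := TopologicalSpace.induced ev inferInstance
    refine isOpen_iff_mem_nhds.2 fun y (hy : d x₀ y < ε) => ?_
    obtain ⟨F, hF, δ, hδ, h⟩ := hsmall (ε - d x₀ y) (by linarith)
    have hev' : ∀ᶠ z in nhds y, ∀ f ∈ F, ‖ev y f - ev z f‖ < δ := by
      refine (Filter.eventually_all_finite hF).2 fun f _ => ?_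
      have hc : Continuous fun z => ev z f :=
        (continuous_apply f).comp (continuous_induced_dom (f := ev))
      filter_upwards [Metric.continuous_iff'.1 hc y δ hδ] with z hz
      rwa [dist_comm, dist_eq_norm] at hz
    filter_upwards [hev'] with z hz
    have := h y z hz
    have := d_tri x₀ y z
    change d x₀ z < ε
    linarith

end TotalBoundedness

theorem TotallyBoundedModScalars.exists_norm_sub_le_add {𝕜 E : Type*} [RCLike 𝕜]
    [AddCommGroup E] [Module 𝕜 E] {S : Set (E →ₗ[𝕜] 𝕜)} {B : Set E}
    (h : TotallyBoundedModScalars S B) {ε : ℝ} (hε : 0 < ε) :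
    ∃ F : Set E, F.Finite ∧ ∀ b ∈ B, ∃ f ∈ F, ∀ φ ∈ S, ∀ ψ ∈ S,
      ‖φ b - ψ b‖ ≤ ‖φ f - ψ f‖ + ε := by
  obtain ⟨F, hF, hB⟩ := h (ε / 2) (half_pos hε)
  refine ⟨F, hF, fun b hb => ?_⟩
  obtain ⟨f, hf, c, hc⟩ := hB b hb
  refine ⟨f, hf, fun φ hφ ψ hψ => ?_⟩
  have hsplit : φ b - ψ b = (φ f - ψ f) + ((φ b - φ f - c) - (ψ b - ψ f - c)) := by ring
  rw [hsplit]
  refine (norm_add_le _ _).trans (add_le_add le_rfl ?_)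
  refine (norm_sub_le _ _).trans ?_
  linarith [hc φ hφ, hc ψ hψ]

/-- A sublinear functional dominates a linear functional agreeing with it at a given point. -/
theorem exists_linearMap_le_sublinear_eq {E : Type*} [AddCommGroup E] [Module ℝ E] (N : E → ℝ)
    (N_hom : ∀ c : ℝ, 0 < c → ∀ x, N (c • x) = c * N x)
    (N_add : ∀ x y, N (x + y) ≤ N x + N y) (z : E) :
    ∃ g : E →ₗ[ℝ] ℝ, (∀ x, g x ≤ N x) ∧ g z = N z := by
  have N_zero : N 0 = 0 := by
    have := N_hom 2 two_pos 0
    rw [smul_zero] at this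
    linarith
  have hneg : ∀ t : ℝ, t * N z ≤ N (t • z) := by
    intro t
    rcases lt_trichotomy t 0 with ht | rfl | ht
    · have h1 := N_add (t • z) ((-t) • z)
      rw [← add_smul, add_neg_cancel, zero_smul, N_zero, N_hom (-t) (neg_pos.2 ht)] at h1
      linarith
    · simp [N_zero]
    · rw [N_hom t ht]
  have H : ∀ c : ℝ, c • z = 0 → c • N z = 0 := by
    intro c hc
    rcases smul_eq_zero.1 hc with rfl | rfl
    · simp
    · simp [N_zero]
  obtain ⟨g, hgz, hg⟩ := exists_extension_of_le_sublinear
    (LinearPMap.mkSpanSingleton' z (N z) H) N N_hom N_add (by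
    rintro ⟨x, hx⟩
    obtain ⟨t, rfl⟩ := Submodule.mem_span_singleton.1 hx
    rw [LinearPMap.mkSpanSingleton'_apply]
    exact hneg t)
  refine ⟨g, hg, ?_⟩
  exact (hgz ⟨z, Submodule.mem_span_singleton_self z⟩).trans
    (LinearPMap.mkSpanSingleton'_apply_self z (N z) H _)

/-! ### Order unit spaces -/

namespace OUS

variable (A : OUS)

theorem zero_mem_pos : (0 : A.carrier) ∈ A.pos := by
  simpa using A.pos_smul 0 le_rfl _ A.one_mem_pos

theorem states_eq_posStates : States A = posStates ℝ A.one A.pos := by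
  ext μ
  simp [States, posStates, IsPosFunctional]

theorem isOrderBounding : IsOrderBounding ℝ A.one A.pos where
  zero_mem := A.zero_mem_pos
  one_mem := A.one_mem_pos
  bound a := by
    obtain ⟨s, hs, hs'⟩ := A.orderUnit a
    obtain ⟨t, ht, ht'⟩ := A.orderUnit (-a)
    refine ⟨max s t, fun f hf => ?_⟩
    have h0 := (hf _ A.one_mem_pos).1
    have h1 := (hf _ hs').1
    have h2 := (hf _ ht').1
    simp only [map_sub, map_smul, map_neg, smul_eq_mul, RCLike.re_to_real] at h0 h1 h2 ⊢
    rw [Real.norm_eq_abs, abs_le]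
    have h3 := mul_le_mul_of_nonneg_right (le_max_left s t) h0
    have h4 := mul_le_mul_of_nonneg_right (le_max_right s t) h0
    constructor <;> linarith

variable {A} {L : A.carrier → ℝ}

theorem abs_sub_le_mul_rhoL (L_nonneg : ∀ a, 0 ≤ L a) (L_smul : ∀ (t : ℝ) a, L (t • a) = |t| * L a)
    (L_null : ∀ a, L a = 0 → ∃ t : ℝ, a = t • A.one) {μ ν : A.carrier →ₗ[ℝ] ℝ}
    (hμ : μ ∈ States A) (hν : ν ∈ States A) (hb : BddAbove {x | ∃ a, L a ≤ 1 ∧ x = |μ a - ν a|})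
    (a : A.carrier) : |μ a - ν a| ≤ L a * rhoL A L μ ν := by
  rcases (L_nonneg a).eq_or_lt with h | h
  · obtain ⟨t, rfl⟩ := L_null a h.symm
    simp [hμ.1, hν.1, ← h]
  · have h1 : |μ ((L a)⁻¹ • a) - ν ((L a)⁻¹ • a)| ≤ rhoL A L μ ν := by
      refine le_csSup hb ⟨_, ?_, rfl⟩
      rw [L_smul, abs_of_pos (inv_pos.2 h), inv_mul_cancel₀ h.ne']
    rw [map_smul, map_smul, ← smul_sub, smul_eq_mul, abs_mul, abs_of_pos (inv_pos.2 h),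
      inv_mul_le_iff₀ h] at h1
    exact h1

theorem rhoL_nonneg (μ ν : A.carrier →ₗ[ℝ] ℝ) : 0 ≤ rhoL A L μ ν := by
  refine Real.sSup_nonneg ?_
  rintro _ ⟨a, -, rfl⟩
  exact abs_nonneg _

theorem range_val_states : Set.range (fun μ : {μ // μ ∈ States A} => μ.1) =
    posStates ℝ A.one A.pos := by
  rw [Subtype.range_val, A.states_eq_posStates]

theorem bddAbove_of_isLipNormOUS (h : IsLipNormOUS A L) {μ ν : A.carrier →ₗ[ℝ] ℝ}
    (hμ : μ ∈ States A) (hν : ν ∈ States A) : BddAbove {x | ∃ a, L a ≤ 1 ∧ x = |μ a - ν a|} :=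
  bddAbove_diffValues (B := {a | L a ≤ 1}) range_val_states h.top_eq ⟨μ, hμ⟩ ⟨ν, hν⟩

theorem totallyBoundedModScalars_of_isLipNormOUS (h : IsLipNormOUS A L) :
    TotallyBoundedModScalars (posStates ℝ A.one A.pos) {a | L a ≤ 1} :=
  totallyBoundedModScalars_of_generateFrom_eq (B := {a | L a ≤ 1}) range_val_states
    A.isOrderBounding h.top_eq

theorem rhoTop_eq_wTop (L_nonneg : ∀ a, 0 ≤ L a)
    (L_smul : ∀ (t : ℝ) a, L (t • a) = |t| * L a)
    (L_null : ∀ a, L a = 0 → ∃ t : ℝ, a = t • A.one)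
    (hL : TotallyBoundedModScalars (posStates ℝ A.one A.pos) {a | L a ≤ 1}) :
    rhoTop A L = wTop A := by
  rw [← A.states_eq_posStates] at hL
  have hbdd : ∀ μ ∈ States A, ∀ ν ∈ States A,
      BddAbove {x | ∃ a, L a ≤ 1 ∧ x = |μ a - ν a|} := by
    intro μ hμ ν hν
    obtain ⟨F, hF, hB⟩ := hL.exists_norm_sub_le_add one_pos
    obtain ⟨M, hM⟩ := (hF.image fun f => ‖μ f - ν f‖).bddAbove
    refine ⟨M + 1, ?_⟩
    rintro _ ⟨a, ha, rfl⟩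
    obtain ⟨f, hf, h⟩ := hB a ha
    exact (h μ hμ ν hν).trans (add_le_add (hM ⟨f, hf, rfl⟩) le_rfl)
  refine generateFrom_balls_eq_induced (fun (μ : {μ // μ ∈ States A}) a => μ.1 a)
    (fun μ ν => rhoL A L μ.1 ν.1) (fun μ => ?_) (fun μ ν => rhoL_nonneg _ _)
    (fun μ ν κ => ?_) (fun v => ?_) (fun ε hε => ?_)
  · refine le_antisymm (Real.sSup_le ?_ le_rfl) (rhoL_nonneg _ _)
    rintro _ ⟨a, -, rfl⟩
    simp
  · refine Real.sSup_le ?_ (add_nonneg (rhoL_nonneg _ _) (rhoL_nonneg _ _))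
    rintro _ ⟨a, ha, rfl⟩
    exact (abs_sub_le _ (ν.1 a) _).trans (add_le_add
      (le_csSup (hbdd _ μ.2 _ ν.2) ⟨a, ha, rfl⟩) (le_csSup (hbdd _ ν.2 _ κ.2) ⟨a, ha, rfl⟩))
  · exact ⟨L v, fun μ ν =>
      abs_sub_le_mul_rhoL L_nonneg L_smul L_null μ.2 ν.2 (hbdd _ μ.2 _ ν.2) v⟩
  · obtain ⟨F, hF, hB⟩ := hL.exists_norm_sub_le_add (ε := ε / 3) (by positivity)
    refine ⟨F, hF, ε / 3, by positivity, fun μ ν h => ?_⟩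
    refine (Real.sSup_le ?_ (by positivity)).trans_lt (show ε / 3 + ε / 3 < ε by linarith)
    rintro _ ⟨a, ha, rfl⟩
    obtain ⟨f, hf, h'⟩ := hB a ha
    exact (h' _ μ.2 _ ν.2).trans (add_le_add (h f hf).le le_rfl)

/-! ### Approximation of Lipschitz elements -/

variable (A) in
/-- The upper bound of an element over the states. -/
def upper (a : A.carrier) : ℝ := sSup {x | ∃ μ ∈ States A, x = μ a}

theorem le_upper (a : A.carrier) {μ : A.carrier →ₗ[ℝ] ℝ} (hμ : μ ∈ States A) :
    μ a ≤ A.upper a := by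
  obtain ⟨R, -, hR⟩ := A.isOrderBounding.exists_norm_le a
  refine le_csSup ⟨R, ?_⟩ ⟨μ, hμ, rfl⟩
  rintro _ ⟨ν, hν, rfl⟩
  rw [states_eq_posStates] at hν
  exact (le_abs_self _).trans (hR ν hν)

theorem upper_le (hne : (States A).Nonempty) {a : A.carrier} {c : ℝ}
    (h : ∀ μ ∈ States A, μ a ≤ c) : A.upper a ≤ c := by
  refine csSup_le ?_ ?_
  · obtain ⟨μ, hμ⟩ := hne
    exact ⟨_, μ, hμ, rfl⟩
  · rintro _ ⟨μ, hμ, rfl⟩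
    exact h μ hμ

theorem upper_add_le (hne : (States A).Nonempty) (a b : A.carrier) :
    A.upper (a + b) ≤ A.upper a + A.upper b :=
  upper_le hne fun μ hμ => by
    rw [map_add]
    exact add_le_add (le_upper a hμ) (le_upper b hμ)

theorem upper_smul (hne : (States A).Nonempty) {c : ℝ} (hc : 0 < c) (a : A.carrier) :
    A.upper (c • a) = c * A.upper a := by
  apply le_antisymm
  · refine upper_le hne fun μ hμ => ?_
    rw [map_smul]
    exact mul_le_mul_of_nonneg_left (le_upper a hμ) hc.le
  · rw [← le_div_iff₀' hc]
    refine upper_le hne fun μ hμ => ?_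
    rw [le_div_iff₀' hc]
    simpa using le_upper (c • a) hμ

theorem mem_states_of_le_upper (hne : (States A).Nonempty) {μ : A.carrier →ₗ[ℝ] ℝ}
    (h : ∀ a, μ a ≤ A.upper a) : μ ∈ States A := by
  constructor
  · apply le_antisymm
    · exact (h _).trans (upper_le hne fun ν hν => hν.1.le)
    · have h1 := (h (-A.one)).trans
        (upper_le hne (c := -1) fun ν hν => by rw [map_neg, hν.1])
      rw [map_neg] at h1
      linarith
  · intro v hv
    have h1 := (h (-v)).trans
      (upper_le hne (c := 0) fun ν hν => by rw [map_neg]; linarith [hν.2 v hv])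
    rw [map_neg] at h1
    linarith

/-- An element which is `κ`-Lipschitz on the state space for `ρ_L` is uniformly approximated
by elements of `L`-seminorm at most `κ`, up to an arbitrarily small error. -/
theorem exists_lt_forall_abs_sub_le (hne : (States A).Nonempty) (h : IsLipNormOUS A L)
    {x : A.carrier} {κ κ' η : ℝ} (hκ : 0 ≤ κ) (hκ' : κ < κ') (hη : 0 < η)
    (hx : ∀ μ ∈ States A, ∀ ν ∈ States A, |μ x - ν x| ≤ κ * rhoL A L μ ν) :
    ∃ a, L a < κ' ∧ ∀ μ ∈ States A, |μ a - μ x| ≤ η := by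
  set s : ℝ := κ' / η with hs
  have hκ'0 : 0 < κ' := hκ.trans_lt hκ'
  have hs0 : 0 < s := div_pos hκ'0 hη
  let g : A.carrier × A.carrier → A.carrier → ℝ := fun p a =>
    L a + s * (A.upper (p.1 - a) + A.upper (p.2 + a))
  have hgbdd : ∀ p, BddBelow (Set.range (g p)) := by
    intro p
    refine ⟨s * A.upper (p.1 + p.2), ?_⟩
    rintro _ ⟨a, rfl⟩
    have h1 := upper_add_le hne (p.1 - a) (p.2 + a)
    rw [show p.1 - a + (p.2 + a) = p.1 + p.2 by abel] at h1
    have h2 := mul_le_mul_of_nonneg_left h1 hs0.le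
    have h3 := h.nonneg a
    change _ ≤ L a + s * (A.upper (p.1 - a) + A.upper (p.2 + a))
    linarith
  let N : A.carrier × A.carrier → ℝ := fun p => ⨅ a, g p a
  have hNle : ∀ p a, N p ≤ g p a := fun p a => ciInf_le (hgbdd p) a
  have hNsmul : ∀ c : ℝ, 0 < c → ∀ p, N (c • p) = c * N p := by
    intro c hc p
    have hgc : ∀ a, g (c • p) (c • a) = c * g p a := by
      intro a
      simp only [g, Prod.smul_fst, Prod.smul_snd, ← smul_sub, ← smul_add, upper_smul hne hc,
        h.smul_eq, abs_of_pos hc]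
      ring
    apply le_antisymm
    · rw [← div_le_iff₀' hc]
      refine le_ciInf fun a => ?_
      rw [div_le_iff₀' hc, ← hgc]
      exact hNle _ _
    · refine le_ciInf fun a => ?_
      have : a = c • c⁻¹ • a := by rw [smul_inv_smul₀ hc.ne']
      rw [this, hgc]
      exact mul_le_mul_of_nonneg_left (hNle _ _) hc.le
  have hNadd : ∀ p q, N (p + q) ≤ N p + N q := by
    intro p q
    refine le_ciInf_add_ciInf fun a b => ?_
    refine (hNle _ (a + b)).trans ?_
    have h1 := upper_add_le hne (p.1 - a) (q.1 - b)
    have h2 := upper_add_le hne (p.2 + a) (q.2 + b)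
    rw [show p.1 - a + (q.1 - b) = p.1 + q.1 - (a + b) by abel] at h1
    rw [show p.2 + a + (q.2 + b) = p.2 + q.2 + (a + b) by abel] at h2
    have h3 := h.add_le a b
    have h4 := mul_le_mul_of_nonneg_left (add_le_add h1 h2) hs0.le
    simp only [g, Prod.fst_add, Prod.snd_add]
    linarith
  obtain ⟨F, hF, hFx⟩ := exists_linearMap_le_sublinear_eq N hNsmul hNadd (x, -x)
  have upper_zero : A.upper 0 ≤ 0 := upper_le hne fun μ _ => by simp
  have L_zero : L 0 = 0 := (h.null_iff 0).2 ⟨0, by simp⟩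
  set μ : A.carrier →ₗ[ℝ] ℝ := s⁻¹ • (F ∘ₗ LinearMap.inl ℝ A.carrier A.carrier) with hμdef
  set ν : A.carrier →ₗ[ℝ] ℝ := s⁻¹ • (F ∘ₗ LinearMap.inr ℝ A.carrier A.carrier) with hνdef
  have hμ : μ ∈ States A := by
    refine mem_states_of_le_upper hne fun a => ?_
    have h1 := (hF (a, 0)).trans (hNle _ 0)
    simp only [g, L_zero, sub_zero, add_zero, zero_add] at h1
    have h2 := mul_le_mul_of_nonneg_left upper_zero hs0.le
    simp only [hμdef, LinearMap.smul_apply, LinearMap.comp_apply, LinearMap.inl_apply,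
      smul_eq_mul]
    rw [inv_mul_le_iff₀ hs0]
    linarith
  have hν : ν ∈ States A := by
    refine mem_states_of_le_upper hne fun a => ?_
    have h1 := (hF (0, a)).trans (hNle _ 0)
    simp only [g, L_zero, sub_zero, add_zero, zero_add] at h1
    have h2 := mul_le_mul_of_nonneg_left upper_zero hs0.le
    simp only [hνdef, LinearMap.smul_apply, LinearMap.comp_apply, LinearMap.inr_apply,
      smul_eq_mul]
    rw [inv_mul_le_iff₀ hs0]
    linarith
  have hFsub : ∀ a, F (a, -a) = s * (μ a - ν a) := by
    intro a
    have h1 : (a, -a) = (a, (0 : A.carrier)) - ((0 : A.carrier), a) := by simp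
    rw [h1, map_sub]
    simp only [hμdef, hνdef, LinearMap.smul_apply, LinearMap.comp_apply, LinearMap.inl_apply,
      LinearMap.inr_apply, smul_eq_mul]
    field_simp
  have hFL : ∀ a, F (a, -a) ≤ L a := by
    intro a
    have h1 := (hF (a, -a)).trans (hNle _ a)
    simp only [g, sub_self, neg_add_cancel] at h1
    have h2 := mul_le_mul_of_nonneg_left upper_zero hs0.le
    linarith
  have hρ : s * rhoL A L μ ν ≤ 1 := by
    rw [← le_div_iff₀' hs0]
    refine Real.sSup_le ?_ (by positivity)
    rintro _ ⟨a, ha, rfl⟩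
    have h0 : s * |μ a - ν a| = |s * (μ a - ν a)| := by rw [abs_mul, abs_of_pos hs0]
    rw [le_div_iff₀' hs0, h0, ← hFsub]
    have h1 := hFL (-a)
    have h2 : F (-a, - -a) = -F (a, -a) := by
      rw [← map_neg]
      rfl
    have h3 : L (-a) = L a := by
      have := h.smul_eq (-1) a
      simpa using this
    exact abs_le.2 ⟨by linarith, (hFL a).trans ha⟩
  have hNx : N (x, -x) ≤ κ := by
    rw [← hFx, hFsub]
    have h1 := (le_abs_self _).trans (hx μ hμ ν hν)
    have h2 := mul_le_mul_of_nonneg_left h1 hs0.le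
    nlinarith
  obtain ⟨a, ha⟩ := exists_lt_of_ciInf_lt (hNx.trans_lt hκ')
  have hosc : 0 ≤ A.upper (x - a) + A.upper (-x + a) := by
    obtain ⟨ω, hω⟩ := hne
    have h1 := le_upper (x - a) hω
    have h2 := le_upper (-x + a) hω
    simp only [map_sub, map_add, map_neg] at h1 h2
    linarith
  have hosc' : A.upper (x - a) + A.upper (-x + a) ≤ η := by
    have h1 : s * (A.upper (x - a) + A.upper (-x + a)) < κ' := by
      have := h.nonneg a
      simp only [g] at ha
      linarith
    have h2 : κ' = s * η := by rw [hs, div_mul_cancel₀ _ hη.ne']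
    rw [h2] at h1
    exact (lt_of_mul_lt_mul_left h1 hs0.le).le
  set c := A.upper (x - a) with hc
  have hL1 : L (a + c • A.one) ≤ L a := by
    have h1 := h.add_le a (c • A.one)
    rw [(h.null_iff _).2 ⟨c, rfl⟩] at h1
    linarith
  refine ⟨a + c • A.one, ?_, fun ω hω => ?_⟩
  · have := mul_nonneg hs0.le hosc
    simp only [g] at ha
    linarith
  · have h1 := le_upper (x - a) hω
    have h2 := le_upper (-x + a) hω
    simp only [map_sub, map_add, map_neg] at h1 h2
    rw [map_add, map_smul, hω.1, smul_eq_mul, mul_one, abs_le]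
    constructor <;> linarith

end OUS

/-! ### Operator norms of scalar matrices -/

section ScalarOpNorm

open Matrix WithLp

variable {m n l : Type*} [Fintype m] [Fintype n] [Fintype l] [DecidableEq n]

theorem scalarOpNorm_nonneg (γ : Matrix m n ℂ) : 0 ≤ scalarOpNorm γ :=
  norm_nonneg _

theorem norm_dotProduct_mulVec_le (γ : Matrix m n ℂ) (x : m → ℂ) (y : n → ℂ) :
    ‖star x ⬝ᵥ (γ *ᵥ y)‖ ≤ scalarOpNorm γ * (‖toLp 2 x‖ * ‖toLp 2 y‖) := by
  have h1 : star x ⬝ᵥ (γ *ᵥ y) = inner ℂ (toLp 2 x) (Matrix.toEuclideanLin γ (toLp 2 y)) := by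
    rw [EuclideanSpace.inner_eq_star_dotProduct, dotProduct_comm]
    rfl
  rw [h1]
  refine (norm_inner_le_norm _ _).trans ?_
  have h2 := (LinearMap.toContinuousLinearMap (Matrix.toEuclideanLin γ)).le_opNorm (toLp 2 y)
  calc _ ≤ ‖toLp 2 x‖ * (scalarOpNorm γ * ‖toLp 2 y‖) :=
        mul_le_mul_of_nonneg_left h2 (norm_nonneg _)
    _ = _ := by ring

theorem scalarOpNorm_le_of_dotProduct {γ : Matrix m n ℂ} {M : ℝ} (hM : 0 ≤ M)
    (h : ∀ x y, ‖star x ⬝ᵥ (γ *ᵥ y)‖ ≤ M * (‖toLp 2 x‖ * ‖toLp 2 y‖)) :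
    scalarOpNorm γ ≤ M := by
  refine ContinuousLinearMap.opNorm_le_bound _ hM fun y => ?_
  set z := Matrix.toEuclideanLin γ y with hz
  change ‖z‖ ≤ _
  have h1 := h (ofLp z) (ofLp y)
  have h2 : star (ofLp z) ⬝ᵥ (γ *ᵥ ofLp y) = inner ℂ z z := by
    rw [EuclideanSpace.inner_eq_star_dotProduct, dotProduct_comm]
    rfl
  rw [h2, inner_self_eq_norm_sq_to_K, norm_pow, RCLike.norm_ofReal, abs_norm, toLp_ofLp,
    toLp_ofLp] at h1
  rcases (norm_nonneg z).eq_or_lt with h3 | h3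
  · rw [← h3]
    positivity
  · nlinarith

theorem scalarOpNorm_add_le (α β : Matrix m n ℂ) :
    scalarOpNorm (α + β) ≤ scalarOpNorm α + scalarOpNorm β := by
  unfold scalarOpNorm
  rw [map_add, map_add]
  exact norm_add_le _ _

theorem scalarOpNorm_smul (c : ℂ) (α : Matrix m n ℂ) :
    scalarOpNorm (c • α) = ‖c‖ * scalarOpNorm α := by
  unfold scalarOpNorm
  rw [map_smul, map_smul, norm_smul]

theorem scalarOpNorm_zero : scalarOpNorm (0 : Matrix m n ℂ) = 0 := by
  simpa using scalarOpNorm_smul (0 : ℂ) (0 : Matrix m n ℂ)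

open scoped Matrix.Norms.L2Operator in
theorem scalarOpNorm_mul_le [DecidableEq l] (α : Matrix m n ℂ) (β : Matrix n l ℂ) :
    scalarOpNorm (α * β) ≤ scalarOpNorm α * scalarOpNorm β :=
  l2_opNorm_mul α β

open scoped Matrix.Norms.L2Operator in
theorem scalarOpNorm_conjTranspose [DecidableEq m] (α : Matrix m n ℂ) :
    scalarOpNorm αᴴ = scalarOpNorm α :=
  l2_opNorm_conjTranspose α

theorem norm_toLp_single [DecidableEq m] (i : m) : ‖toLp 2 (Pi.single i 1 : m → ℂ)‖ = 1 := by
  simp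

theorem norm_entry_le_scalarOpNorm (γ : Matrix m n ℂ) (i : m) (j : n) :
    ‖γ i j‖ ≤ scalarOpNorm γ := by
  classical
  have h := norm_dotProduct_mulVec_le γ (Pi.single i 1) (Pi.single j 1)
  have h1 : star (Pi.single i 1 : m → ℂ) = Pi.single i 1 := by
    rw [← Pi.single_star, star_one]
  simpa [norm_toLp_single, h1] using h

theorem eq_zero_of_scalarOpNorm_eq_zero {γ : Matrix m n ℂ} (h : scalarOpNorm γ = 0) : γ = 0 := by
  ext i j
  exact norm_le_zero_iff.1 ((norm_entry_le_scalarOpNorm γ i j).trans h.le)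

theorem scalarOpNorm_of_unique [Unique n] (γ : Matrix n n ℂ) :
    scalarOpNorm γ = ‖γ default default‖ := by
  refine le_antisymm (scalarOpNorm_le_of_dotProduct (norm_nonneg _) fun x y => ?_)
    (norm_entry_le_scalarOpNorm _ _ _)
  simp only [dotProduct, mulVec, Finset.univ_unique, Finset.sum_singleton, EuclideanSpace.norm_eq,
    Pi.star_apply, norm_mul, norm_star, Real.sqrt_sq (norm_nonneg _)]
  exact le_of_eq (by ring)

/-- The norm of a column is its Euclidean norm; only the upper bound is needed. -/
theorem scalarOpNorm_col_le (y : m → ℂ) :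
    scalarOpNorm (Matrix.of fun i (_ : Fin 1) => y i) ≤ ‖toLp 2 y‖ := by
  refine ContinuousLinearMap.opNorm_le_bound _ (norm_nonneg _) fun t => ?_
  have h1 : Matrix.toEuclideanLin (Matrix.of fun i (_ : Fin 1) => y i) t = t 0 • toLp 2 y := by
    ext i
    simp [Matrix.toLpLin_apply, mulVec, dotProduct, mul_comm]
  change ‖Matrix.toEuclideanLin (Matrix.of fun i (_ : Fin 1) => y i) t‖ ≤ _
  rw [h1, norm_smul, EuclideanSpace.norm_eq t]
  simp [mul_comm]

theorem scalarOpNorm_row_le [DecidableEq m] (y : m → ℂ) :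
    scalarOpNorm (Matrix.of fun (_ : Fin 1) i => star (y i)) ≤ ‖toLp 2 y‖ := by
  have h : (Matrix.of fun (_ : Fin 1) i => star (y i)) =
      (Matrix.of fun i (_ : Fin 1) => y i)ᴴ := rfl
  rw [h, scalarOpNorm_conjTranspose]
  exact scalarOpNorm_col_le y

theorem norm_toLp_sq (x : m → ℂ) : ‖toLp 2 x‖ ^ 2 = ∑ i, ‖x i‖ ^ 2 := by
  rw [EuclideanSpace.norm_eq, Real.sq_sqrt (Finset.sum_nonneg fun i _ => sq_nonneg _)]

theorem norm_toLp_comp_le (f : l → m) (hf : Function.Injective f) (x : m → ℂ) :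
    ‖toLp 2 (x ∘ f)‖ ≤ ‖toLp 2 x‖ := by
  classical
  refine (sq_le_sq₀ (norm_nonneg _) (norm_nonneg _)).1 ?_
  rw [norm_toLp_sq, norm_toLp_sq]
  have h := Finset.sum_image (s := Finset.univ) (f := fun i => ‖x i‖ ^ 2) (g := f) hf.injOn
  simp only [Function.comp_apply]
  rw [← h]
  exact Finset.sum_le_univ_sum_of_nonneg fun i => sq_nonneg _

end ScalarOpNorm

section BlockDiagonal

open Matrix WithLp

variable {m n : ℕ}

theorem dotProduct_dsumMat_mulVec (α : Matrix (Fin m) (Fin m) ℂ) (β : Matrix (Fin n) (Fin n) ℂ)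
    (x y : Fin (m + n) → ℂ) :
    star x ⬝ᵥ (dsumMat α β *ᵥ y) =
      star (x ∘ Fin.castAdd n) ⬝ᵥ (α *ᵥ (y ∘ Fin.castAdd n)) +
      star (x ∘ Fin.natAdd m) ⬝ᵥ (β *ᵥ (y ∘ Fin.natAdd m)) := by
  simp [dotProduct, mulVec, dsumMat, Fin.sum_univ_add, Matrix.reindex_apply]

theorem scalarOpNorm_dsumMat (α : Matrix (Fin m) (Fin m) ℂ) (β : Matrix (Fin n) (Fin n) ℂ) :
    scalarOpNorm (dsumMat α β) = max (scalarOpNorm α) (scalarOpNorm β) := by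
  apply le_antisymm
  · set M := max (scalarOpNorm α) (scalarOpNorm β) with hMdef
    have hM : 0 ≤ M := (scalarOpNorm_nonneg α).trans (le_max_left _ _)
    refine scalarOpNorm_le_of_dotProduct hM fun x y => ?_
    rw [dotProduct_dsumMat_mulVec]
    set x₁ := x ∘ Fin.castAdd n
    set x₂ := x ∘ Fin.natAdd m
    set y₁ := y ∘ Fin.castAdd n
    set y₂ := y ∘ Fin.natAdd m
    have hx : ‖toLp 2 x‖ ^ 2 = ‖toLp 2 x₁‖ ^ 2 + ‖toLp 2 x₂‖ ^ 2 := by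
      simp only [norm_toLp_sq, Fin.sum_univ_add, x₁, x₂, Function.comp_apply]
    have hy : ‖toLp 2 y‖ ^ 2 = ‖toLp 2 y₁‖ ^ 2 + ‖toLp 2 y₂‖ ^ 2 := by
      simp only [norm_toLp_sq, Fin.sum_univ_add, y₁, y₂, Function.comp_apply]
    have h1 := norm_dotProduct_mulVec_le α x₁ y₁
    have h2 := norm_dotProduct_mulVec_le β x₂ y₂
    have h1' := mul_le_mul_of_nonneg_right (le_max_left (scalarOpNorm α) (scalarOpNorm β))
      (mul_nonneg (norm_nonneg (toLp 2 x₁)) (norm_nonneg (toLp 2 y₁)))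
    have h2' := mul_le_mul_of_nonneg_right (le_max_right (scalarOpNorm α) (scalarOpNorm β))
      (mul_nonneg (norm_nonneg (toLp 2 x₂)) (norm_nonneg (toLp 2 y₂)))
    have h3 : ‖toLp 2 x₁‖ * ‖toLp 2 y₁‖ + ‖toLp 2 x₂‖ * ‖toLp 2 y₂‖ ≤
        ‖toLp 2 x‖ * ‖toLp 2 y‖ := by
      refine abs_le_of_sq_le_sq' ?_ (by positivity) |>.2
      rw [mul_pow, hx, hy]
      nlinarith [sq_nonneg (‖toLp 2 x₁‖ * ‖toLp 2 y₂‖ - ‖toLp 2 x₂‖ * ‖toLp 2 y₁‖)]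
    have h4 := mul_le_mul_of_nonneg_left h3 hM
    refine (norm_add_le _ _).trans ?_
    linarith
  · refine max_le ?_ ?_
    · refine scalarOpNorm_le_of_dotProduct (scalarOpNorm_nonneg _) fun x y => ?_
      have h := norm_dotProduct_mulVec_le (dsumMat α β) (Fin.append x 0) (Fin.append y 0)
      rw [dotProduct_dsumMat_mulVec] at h
      have hn : ∀ z : Fin m → ℂ, ‖toLp 2 (Fin.append z (0 : Fin n → ℂ))‖ = ‖toLp 2 z‖ := by
        intro z
        refine (sq_eq_sq₀ (norm_nonneg _) (norm_nonneg _)).1 ?_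
        simp [norm_toLp_sq, Fin.sum_univ_add]
      have hc : ∀ z : Fin m → ℂ, Fin.append z (0 : Fin n → ℂ) ∘ Fin.castAdd n = z := by
        intro z; ext i; simp
      have hc' : ∀ z : Fin m → ℂ, Fin.append z (0 : Fin n → ℂ) ∘ Fin.natAdd m = 0 := by
        intro z; ext i; simp
      simpa [hn, hc, hc'] using h
    · refine scalarOpNorm_le_of_dotProduct (scalarOpNorm_nonneg _) fun x y => ?_
      have h := norm_dotProduct_mulVec_le (dsumMat α β) (Fin.append 0 x) (Fin.append 0 y)
      rw [dotProduct_dsumMat_mulVec] at h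
      have hn : ∀ z : Fin n → ℂ, ‖toLp 2 (Fin.append (0 : Fin m → ℂ) z)‖ = ‖toLp 2 z‖ := by
        intro z
        refine (sq_eq_sq₀ (norm_nonneg _) (norm_nonneg _)).1 ?_
        simp [norm_toLp_sq, Fin.sum_univ_add]
      have hc : ∀ z : Fin n → ℂ, Fin.append (0 : Fin m → ℂ) z ∘ Fin.natAdd m = z := by
        intro z; ext i; simp
      have hc' : ∀ z : Fin n → ℂ, Fin.append (0 : Fin m → ℂ) z ∘ Fin.castAdd n = 0 := by
        intro z; ext i; simp
      simpa [hn, hc, hc'] using h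

end BlockDiagonal

/-! ### Matrix order unit spaces -/

/-- A vector as a one-by-one matrix. -/
def oneMat {V : Type} (v : V) : Matrix (Fin 1) (Fin 1) V := Matrix.of fun _ _ => v

theorem oneMat_add {V : Type} [AddCommGroup V] (v w : V) :
    oneMat (v + w) = oneMat v + oneMat w := rfl

theorem oneMat_smul {V : Type} [AddCommGroup V] [Module ℂ V] (c : ℂ) (v : V) :
    oneMat (c • v) = c • oneMat v := rfl

theorem oneMat_apply_zero {V : Type} (a : Matrix (Fin 1) (Fin 1) V) : oneMat (a 0 0) = a := by
  ext i j
  rw [Subsingleton.elim i 0, Subsingleton.elim j 0]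
  rfl

namespace MOUS

variable (V : MOUS)

/-- The positive elements of a matrix order unit space. -/
def posSet : Set V.carrier := {v | oneMat v ∈ V.pos 1}

theorem one_mem_posSet : V.one ∈ V.posSet := by
  have h := V.unit_pos 1
  rwa [← oneMat_apply_zero (Matrix.diagonal _), Matrix.diagonal_apply_eq] at h

theorem zero_mem_posSet : (0 : V.carrier) ∈ V.posSet := by
  have h := V.pos_smul 1 0 le_rfl _ V.one_mem_posSet
  rwa [← oneMat_smul, Complex.ofReal_zero, zero_smul] at h

theorem exists_bound_of_star_eq {h : V.carrier} (hh : star h = h) :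
    ∃ R : ℝ, ∀ f : V.carrier →ₗ[ℂ] ℂ, IsPosFunctional V.posSet f →
      (f h).im = 0 ∧ |(f h).re| ≤ R * (f V.one).re := by
  obtain ⟨s, hs, hs'⟩ := V.orderUnit h hh
  obtain ⟨t, ht, ht'⟩ := V.orderUnit (-h) (by rw [star_neg, hh])
  refine ⟨max s t, fun f hf => ?_⟩
  have h0 := hf _ V.one_mem_posSet
  have h1 := hf _ hs'
  have h2 := hf _ ht'
  simp only [map_sub, map_smul, map_neg, smul_eq_mul, RCLike.re_to_complex,
    RCLike.im_to_complex, Complex.re_ofReal_mul, Complex.im_ofReal_mul] at h0 h1 h2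
  refine ⟨?_, ?_⟩
  · have h3 := h1.2
    rw [h0.2] at h3
    linarith
  · have h3 := mul_le_mul_of_nonneg_right (le_max_left s t) h0.1
    have h4 := mul_le_mul_of_nonneg_right (le_max_right s t) h0.1
    rw [abs_le]
    constructor <;> linarith [h1.1, h2.1]

open ComplexStarModule in
theorem isOrderBounding : IsOrderBounding ℂ V.one V.posSet where
  zero_mem := V.zero_mem_posSet
  one_mem := V.one_mem_posSet
  bound a := by
    obtain ⟨R, hR⟩ := V.exists_bound_of_star_eq (realPart a).2
    obtain ⟨R', hR'⟩ := V.exists_bound_of_star_eq (imaginaryPart a).2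
    refine ⟨R + R', fun f hf => ?_⟩
    obtain ⟨h1, h2⟩ := hR f hf
    obtain ⟨h3, h4⟩ := hR' f hf
    have h5 : f a = f (realPart a : V.carrier) + Complex.I * f (imaginaryPart a : V.carrier) := by
      conv_lhs => rw [← realPart_add_I_smul_imaginaryPart a]
      simp
    rw [h5, add_mul]
    refine (norm_add_le _ _).trans (add_le_add ?_ ?_)
    · rw [← Complex.abs_re_eq_norm.2 h1]
      exact h2
    · rw [norm_mul, Complex.norm_I, one_mul, ← Complex.abs_re_eq_norm.2 h3]
      exact h4

variable {V}

theorem map_star_of_isPosFunctional {f : V.carrier →ₗ[ℂ] ℂ} (hf : IsPosFunctional V.posSet f)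
    (a : V.carrier) : f (star a) = star (f a) := by
  obtain ⟨R, hR⟩ := V.exists_bound_of_star_eq (realPart a).2
  obtain ⟨R', hR'⟩ := V.exists_bound_of_star_eq (imaginaryPart a).2
  have h1 := (hR f hf).1
  have h3 := (hR' f hf).1
  have h5 := realPart_add_I_smul_imaginaryPart a
  have h6 : star a = (realPart a : V.carrier) - Complex.I • (imaginaryPart a : V.carrier) := by
    conv_lhs => rw [← h5]
    rw [star_add, star_smul, (realPart a).2.star_eq, (imaginaryPart a).2.star_eq]
    simp [sub_eq_add_neg]
  have h7 : f a = f (realPart a : V.carrier) + Complex.I * f (imaginaryPart a : V.carrier) := by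
    conv_lhs => rw [← h5]
    simp
  rw [h6, h7, map_sub, map_smul, smul_eq_mul]
  apply Complex.ext
  · simp [h3]
  · simp [h1, h3]

end MOUS

section MatrixStates

open Matrix WithLp

variable {V : MOUS} {n : ℕ}

theorem posSemidef_apply {φ : MState V n} (hφ : φ ∈ CS V n) {v : V.carrier}
    (hv : v ∈ V.posSet) : (φ v).PosSemidef :=
  (hφ.2 1 _ hv).submatrix fun i => (0, i)

/-- The vector functional `v ↦ ⟨ξ, φ(v) ξ⟩`. -/
def vecFunctional (φ : MState V n) (ξ : Fin n → ℂ) : V.carrier →ₗ[ℂ] ℂ where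
  toFun v := star ξ ⬝ᵥ (φ v *ᵥ ξ)
  map_add' v w := by simp [add_mulVec, dotProduct_add]
  map_smul' c v := by simp [smul_mulVec, dotProduct_smul]

theorem isPosFunctional_vecFunctional {φ : MState V n} (hφ : φ ∈ CS V n) (ξ : Fin n → ℂ) :
    IsPosFunctional V.posSet (vecFunctional φ ξ) := by
  intro v hv
  have h := (posSemidef_apply hφ hv).dotProduct_mulVec_nonneg ξ
  have h' := Complex.le_def.1 h
  exact ⟨h'.1, h'.2.symm⟩

/-- The functional given by an entry of a matrix state. -/
def entryFunctional (φ : MState V n) (i j : Fin n) : V.carrier →ₗ[ℂ] ℂ :=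
  Matrix.entryLinearMap ℂ ℂ i j ∘ₗ φ

@[simp]
theorem entryFunctional_apply (φ : MState V n) (i j : Fin n) (v : V.carrier) :
    entryFunctional φ i j v = φ v i j := rfl

theorem norm_entry_le {φ : MState V n} (hφ : φ ∈ CS V n) {v : V.carrier} {ε : ℝ}
    (h : ∀ ω ∈ posStates ℂ V.one V.posSet, ‖ω v‖ ≤ ε) (i j : Fin n) : ‖φ v i j‖ ≤ 4 * ε := by
  have key : ∀ ξ : Fin n → ℂ, ‖star ξ ⬝ᵥ (φ v *ᵥ ξ)‖ ≤ ε * (star ξ ⬝ᵥ ξ).re := by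
    intro ξ
    have h1 := V.isOrderBounding.norm_le h (isPosFunctional_vecFunctional hφ ξ)
    have h2 : vecFunctional φ ξ V.one = star ξ ⬝ᵥ ξ := by simp [vecFunctional, hφ.1]
    rw [h2] at h1
    exact h1
  have hε : 0 ≤ ε := by
    have h1 := (norm_nonneg _).trans (key (Pi.single i 1))
    simpa [← Pi.single_star] using h1
  let q : ℂ → ℂ := fun z => star (Pi.single i 1 + z • Pi.single j 1) ⬝ᵥ
    (φ v *ᵥ (Pi.single i 1 + z • Pi.single j 1))
  have hq : ∀ z, q z = φ v i i + z * φ v i j + star z * φ v j i + star z * z * φ v j j := by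
    intro z
    simp only [q, star_add, star_smul, ← Pi.single_star, star_one, mulVec_add, mulVec_smul,
      dotProduct_add, add_dotProduct, smul_dotProduct, dotProduct_smul, single_one_dotProduct,
      mulVec_single_one, Matrix.col_apply, smul_eq_mul]
    ring
  have hnorm : ∀ z, ‖z‖ = 1 → ‖q z‖ ≤ 4 * ε := by
    intro z hz
    refine (key _).trans ?_
    rw [mul_comm]
    refine mul_le_mul_of_nonneg_right ?_ hε
    have h2 : star (Pi.single i 1 + z • Pi.single j 1 : Fin n → ℂ) ⬝ᵥ
        (Pi.single i 1 + z • Pi.single j 1) =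
        1 + z * (if i = j then 1 else 0) + star z * (if i = j then 1 else 0) + star z * z := by
      simp only [star_add, star_smul, ← Pi.single_star, star_one,
        dotProduct_add, add_dotProduct, smul_dotProduct, dotProduct_smul, single_one_dotProduct,
        smul_eq_mul, Pi.single_apply, eq_comm (a := j) (b := i), if_true]
      ring
    rw [h2]
    have h3 : star z * z = 1 := by
      rw [mul_comm, Complex.star_def, Complex.mul_conj, Complex.normSq_eq_norm_sq, hz]
      simp
    rw [h3]
    have h4 : z.re ≤ 1 := hz ▸ Complex.re_le_norm z
    split_ifs
    · simp
      linarith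
    · simp
      norm_num
  have hpol : 4 * φ v i j = q 1 - q (-1) - Complex.I * q Complex.I
      + Complex.I * q (-Complex.I) := by
    simp only [hq, star_one, star_neg, Complex.star_def, Complex.conj_I]
    linear_combination (2 * φ v i j - 2 * φ v j i) * Complex.I_mul_I
  have h4 : ‖(4 : ℂ) * φ v i j‖ ≤ 4 * (4 * ε) := by
    rw [hpol]
    have a1 := hnorm 1 (by simp)
    have a2 := hnorm (-1) (by simp)
    have a3 := hnorm Complex.I (by simp)
    have a4 := hnorm (-Complex.I) (by simp)
    refine (norm_add_le _ _).trans ?_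
    have b1 := norm_sub_le (q 1 - q (-1)) (Complex.I * q Complex.I)
    have b2 := norm_sub_le (q 1) (q (-1))
    rw [norm_mul, Complex.norm_I, one_mul] at b1 ⊢
    linarith
  rw [norm_mul] at h4
  norm_num at h4
  linarith

theorem entryFunctional_mem_posStates {φ : MState V 1} (hφ : φ ∈ CS V 1) :
    entryFunctional φ 0 0 ∈ posStates ℂ V.one V.posSet := by
  refine ⟨by simp [hφ.1], fun v hv => ?_⟩
  have h := (posSemidef_apply hφ hv).diag_nonneg (i := 0)
  have h' := Complex.le_def.1 h
  exact ⟨h'.1, h'.2.symm⟩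

/-- A functional as a map to one-by-one matrices. -/
def toMState (ω : V.carrier →ₗ[ℂ] ℂ) : MState V 1 where
  toFun v := oneMat (ω v)
  map_add' v w := by rw [map_add, oneMat_add]
  map_smul' c v := by rw [map_smul, smul_eq_mul]; rfl

@[simp]
theorem entryFunctional_toMState (ω : V.carrier →ₗ[ℂ] ℂ) :
    entryFunctional (toMState ω) 0 0 = ω := rfl

theorem toMState_mem {ω : V.carrier →ₗ[ℂ] ℂ} (hω : ω ∈ posStates ℂ V.one V.posSet) :
    toMState ω ∈ CS V 1 := by
  refine ⟨?_, fun r v hv => ?_⟩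
  · rw [← oneMat_apply_zero (1 : Matrix (Fin 1) (Fin 1) ℂ)]
    change oneMat (ω V.one) = _
    rw [hω.1]
    simp
  · refine .of_dotProduct_mulVec_nonneg ?_ fun x => ?_
    · ext p q
      change star (ω (v q.1 p.1)) = ω (v p.1 q.1)
      rw [← MOUS.map_star_of_isPosFunctional hω.2]
      exact congrArg ω (congrFun (congrFun (V.pos_star r v hv) p.1) q.1)
    · have h := hω.2 (∑ k, ∑ l, (star (x (k, 0)) * x (l, 0)) • v k l)
        (V.pos_congr r 1 (Matrix.of fun k _ => x (k, 0)) v hv)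
      have h2 : star x ⬝ᵥ (mpair (toMState ω) v *ᵥ x) =
          ω (∑ k, ∑ l, (star (x (k, 0)) * x (l, 0)) • v k l) := by
        simp only [dotProduct, mulVec, Fintype.sum_prod_type, Finset.univ_unique,
          Finset.sum_singleton, map_sum, map_smul, smul_eq_mul, Finset.mul_sum]
        refine Finset.sum_congr rfl fun k _ => Finset.sum_congr rfl fun l _ => ?_
        change star (x (k, 0)) * (ω (v k l) * x (l, 0)) = _
        ring
      rw [h2]
      exact Complex.le_def.2 ⟨h.1, h.2.symm⟩

theorem range_entryFunctional :
    Set.range (fun φ : {φ : MState V 1 // φ ∈ CS V 1} => entryFunctional φ.1 0 0) =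
      posStates ℂ V.one V.posSet := by
  ext ω
  constructor
  · rintro ⟨φ, rfl⟩
    exact entryFunctional_mem_posStates φ.2
  · intro hω
    exact ⟨⟨_, toMState_mem hω⟩, entryFunctional_toMState ω⟩

end MatrixStates

/-! ### Matrix Lipschitz seminorms -/

section MatrixLipschitz

open Matrix WithLp

variable {V : MOUS} {L : ∀ n : ℕ, Matrix (Fin n) (Fin n) V.carrier → ℝ} {n : ℕ}

theorem exists_eq_smul_one (hL : IsMatrixLipschitzSeminorm V L) {b : V.carrier}
    (hb : L 1 (oneMat b) = 0) : ∃ c : ℂ, b = c • V.one := by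
  obtain ⟨c, hc⟩ := (hL.null_iff 1 _).1 hb
  exact ⟨c 0 0, congrFun (congrFun hc 0) 0⟩

theorem norm_entry_sub_le (hL : IsMatrixLipschitzSeminorm V L) {φ ψ : MState V n}
    (hφ : φ V.one = 1) (hψ : ψ V.one = 1) {C : ℝ} {i j : Fin n}
    (h : ∀ b, L 1 (oneMat b) ≤ 1 → ‖φ b i j - ψ b i j‖ ≤ C) (b : V.carrier) :
    ‖φ b i j - ψ b i j‖ ≤ C * L 1 (oneMat b) := by
  rcases (hL.nonneg 1 (oneMat b)).eq_or_lt with h0 | h0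
  · obtain ⟨c, rfl⟩ := exists_eq_smul_one hL h0.symm
    simp [hφ, hψ, ← h0]
  · have h1 := h (((L 1 (oneMat b))⁻¹ : ℂ) • b) (by
      rw [oneMat_smul, hL.smul_eq, norm_inv, Complex.norm_real, Real.norm_eq_abs,
        abs_of_pos h0, inv_mul_cancel₀ h0.ne'])
    rw [map_smul, map_smul, Matrix.smul_apply, Matrix.smul_apply, ← smul_sub, norm_smul, norm_inv,
      Complex.norm_real, Real.norm_eq_abs, abs_of_pos h0, inv_mul_le_iff₀ h0] at h1
    linarith

theorem scalarOpNorm_mpair_sub_le (hL : IsMatrixLipschitzSeminorm V L) {φ ψ : MState V n}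
    (hφ : φ V.one = 1) (hψ : ψ V.one = 1) {C : ℝ} (hC : 0 ≤ C)
    (h : ∀ b, L 1 (oneMat b) ≤ 1 → ∀ i j, ‖φ b i j - ψ b i j‖ ≤ C) {r : ℕ}
    (a : Matrix (Fin r) (Fin r) V.carrier) :
    scalarOpNorm (mpair φ a - mpair ψ a) ≤ (n : ℝ) ^ 2 * C * L r a := by
  have hLa := hL.nonneg r a
  refine scalarOpNorm_le_of_dotProduct (by positivity) fun x y => ?_
  let b : Fin n → Fin n → V.carrier := fun i j =>
    ∑ k, ∑ l, (star (x (k, i)) * y (l, j)) • a k l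
  have h1 : star x ⬝ᵥ ((mpair φ a - mpair ψ a) *ᵥ y) =
      ∑ i, ∑ j, (φ (b i j) i j - ψ (b i j) i j) := by
    have e1 : ∀ i j, φ (b i j) i j - ψ (b i j) i j =
        ∑ k, ∑ l, star (x (k, i)) * ((φ (a k l) i j - ψ (a k l) i j) * y (l, j)) := by
      intro i j
      simp only [b, map_sum, map_smul, Matrix.sum_apply, Matrix.smul_apply, smul_eq_mul,
        ← Finset.sum_sub_distrib]
      refine Finset.sum_congr rfl fun k _ => Finset.sum_congr rfl fun l _ => ?_
      ring
    simp only [e1, dotProduct, mulVec, Fintype.sum_prod_type, Finset.mul_sum, Pi.star_apply,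
      Matrix.sub_apply]
    rw [Finset.sum_comm]
    refine Finset.sum_congr rfl fun i _ => ?_
    calc _ = ∑ k, ∑ j, ∑ l, star (x (k, i)) * ((φ (a k l) i j - ψ (a k l) i j) * y (l, j)) := by
          refine Finset.sum_congr rfl fun k _ => ?_
          rw [Finset.sum_comm]
          rfl
      _ = _ := Finset.sum_comm
  have h2 : ∀ i j, ‖φ (b i j) i j - ψ (b i j) i j‖ ≤ C * L r a * (‖toLp 2 x‖ * ‖toLp 2 y‖) := by
    intro i j
    refine (norm_entry_sub_le hL hφ hψ (fun b hb => h b hb i j) _).trans ?_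
    have h3 := hL.mmul_le r 1 (Matrix.of fun _ k => star (x (k, i))) a
      (Matrix.of fun l _ => y (l, j))
    have h4 := (scalarOpNorm_row_le fun k => x (k, i)).trans
      (norm_toLp_comp_le (fun k => (k, i)) (Prod.mk_left_injective i) x)
    have h5 := (scalarOpNorm_col_le fun k => y (k, j)).trans
      (norm_toLp_comp_le (fun k => (k, j)) (Prod.mk_left_injective j) y)
    have h6 : L 1 (oneMat (b i j)) ≤ ‖toLp 2 x‖ * L r a * ‖toLp 2 y‖ := by
      refine h3.trans ?_
      have := scalarOpNorm_nonneg (Matrix.of fun (l : Fin r) (_ : Fin 1) => y (l, j))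
      gcongr
    calc _ ≤ C * (‖toLp 2 x‖ * L r a * ‖toLp 2 y‖) := mul_le_mul_of_nonneg_left h6 hC
      _ = _ := by ring
  rw [h1]
  calc _ ≤ ∑ _i : Fin n, ∑ _j : Fin n, C * L r a * (‖toLp 2 x‖ * ‖toLp 2 y‖) :=
        norm_sum_le_of_le _ fun i _ => norm_sum_le_of_le _ fun j _ => h2 i j
    _ = _ := by
        simp
        ring

theorem Dmet_nonneg (φ ψ : MState V n) : 0 ≤ Dmet V L n φ ψ := by
  refine Real.sSup_nonneg ?_
  rintro _ ⟨r, a, -, rfl⟩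
  exact scalarOpNorm_nonneg _

theorem Dmet_le (hL : IsMatrixLipschitzSeminorm V L) {φ ψ : MState V n}
    (hφ : φ V.one = 1) (hψ : ψ V.one = 1) {C : ℝ} (hC : 0 ≤ C)
    (h : ∀ b, L 1 (oneMat b) ≤ 1 → ∀ i j, ‖φ b i j - ψ b i j‖ ≤ C) :
    Dmet V L n φ ψ ≤ (n : ℝ) ^ 2 * C := by
  refine Real.sSup_le ?_ (by positivity)
  rintro _ ⟨r, a, ha, rfl⟩
  refine (scalarOpNorm_mpair_sub_le hL hφ hψ hC h a).trans ?_
  exact mul_le_of_le_one_right (by positivity) ha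

theorem csSup_eq_of_subset_of_upperBounds {s t : Set ℝ} (hs : s.Nonempty) (hst : s ⊆ t)
    (h : upperBounds s ⊆ upperBounds t) : sSup s = sSup t := by
  by_cases hb : BddAbove s
  · exact le_antisymm (csSup_le_csSup (hb.imp fun _ hx => h hx) hs hst)
      (csSup_le (hs.mono hst) (h (isLUB_csSup hs hb).1))
  · rw [Real.sSup_of_not_bddAbove hb, Real.sSup_of_not_bddAbove fun hb' => hb (hb'.mono hst)]

theorem Dmet_one_eq (hL : IsMatrixLipschitzSeminorm V L) {φ ψ : MState V 1}
    (hφ : φ V.one = 1) (hψ : ψ V.one = 1) :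
    Dmet V L 1 φ ψ = sSup (diffValues (fun φ : MState V 1 => entryFunctional φ 0 0)
      {b | L 1 (oneMat b) ≤ 1} φ ψ) := by
  have L_zero : L 1 (oneMat 0) = 0 := by
    have h0 := hL.smul_eq 1 0 (oneMat 0)
    rwa [← oneMat_smul, smul_zero, norm_zero, zero_mul] at h0
  symm
  refine csSup_eq_of_subset_of_upperBounds ⟨_, 0, ?_, rfl⟩ ?_ ?_
  · change L 1 (oneMat 0) ≤ 1
    rw [L_zero]
    exact zero_le_one
  · rintro _ ⟨b, hb, rfl⟩
    refine ⟨1, oneMat b, hb, ?_⟩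
    let _ : Unique (Fin 1 × Fin 1) := Unique.mk' _
    rw [scalarOpNorm_of_unique]
    rfl
  · rintro C hC _ ⟨r, a, ha, rfl⟩
    have h : ∀ b, L 1 (oneMat b) ≤ 1 → ∀ i j, ‖φ b i j - ψ b i j‖ ≤ C := by
      intro b hb i j
      rw [Subsingleton.elim i 0, Subsingleton.elim j 0]
      exact hC ⟨b, hb, rfl⟩
    have hC0 : 0 ≤ C := (norm_nonneg _).trans (h 0 (by rw [L_zero]; exact zero_le_one) 0 0)
    refine (scalarOpNorm_mpair_sub_le hL hφ hψ hC0 h a).trans ?_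
    simpa using mul_le_of_le_one_right hC0 ha

theorem BWtop_eq_induced (V : MOUS) (n : ℕ) : BWtop V n =
    TopologicalSpace.induced (fun φ v i j => φ.1 v i j) inferInstance :=
  induced_compose

theorem BWtop_one_eq_induced (V : MOUS) : BWtop V 1 =
    TopologicalSpace.induced (fun φ v => entryFunctional φ.1 0 0 v) inferInstance := by
  rw [BWtop_eq_induced]
  exact (congrArg (TopologicalSpace.induced _) (Homeomorph.piCongrRight fun _ : V.carrier =>
    (Homeomorph.funUnique (Fin 1) (Fin 1 → ℂ)).trans
      (Homeomorph.funUnique (Fin 1) ℂ)).isInducing.eq_induced).trans induced_compose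

theorem generateFrom_diffValues_eq (h : IsMatrixLipNorm V L) :
    TopologicalSpace.generateFrom {U | ∃ (x₀ : {φ : MState V 1 // φ ∈ CS V 1}) (ε : ℝ), 0 < ε ∧
      U = {y | sSup (diffValues (fun φ : {φ : MState V 1 // φ ∈ CS V 1} =>
        entryFunctional φ.1 0 0) {b | L 1 (oneMat b) ≤ 1} x₀ y) < ε}} =
      TopologicalSpace.induced (fun φ v => entryFunctional φ.1 0 0 v) inferInstance := by
  rw [← BWtop_one_eq_induced, ← h.top_eq 1]
  have h1 : ∀ x y : {φ : MState V 1 // φ ∈ CS V 1},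
      sSup (diffValues (fun φ : {φ : MState V 1 // φ ∈ CS V 1} =>
        entryFunctional φ.1 0 0) {b | L 1 (oneMat b) ≤ 1} x y) = Dmet V L 1 x.1 y.1 :=
    fun x y => (Dmet_one_eq h.toIsMatrixLipschitzSeminorm x.2.1 y.2.1).symm
  simp only [h1]
  rfl

theorem totallyBoundedModScalars_of_isMatrixLipNorm (h : IsMatrixLipNorm V L) :
    TotallyBoundedModScalars (posStates ℂ V.one V.posSet) {b | L 1 (oneMat b) ≤ 1} :=
  totallyBoundedModScalars_of_generateFrom_eq range_entryFunctional V.isOrderBounding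
    (generateFrom_diffValues_eq h)

theorem exists_finite_entry_sub_le
    (hTB : TotallyBoundedModScalars (posStates ℂ V.one V.posSet) {b | L 1 (oneMat b) ≤ 1})
    {ε : ℝ} (hε : 0 < ε) : ∃ F : Set V.carrier, F.Finite ∧ ∀ b, L 1 (oneMat b) ≤ 1 → ∃ f ∈ F,
      ∀ n, ∀ φ ∈ CS V n, ∀ ψ ∈ CS V n, ∀ i j,
        ‖φ b i j - ψ b i j‖ ≤ ‖φ f i j - ψ f i j‖ + ε := by
  obtain ⟨F, hF, hB⟩ := hTB (ε / 8) (by positivity)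
  refine ⟨F, hF, fun b hb => ?_⟩
  obtain ⟨f, hf, c, hc⟩ := hB b hb
  have key : ∀ ω ∈ posStates ℂ V.one V.posSet, ‖ω (b - f - c • V.one)‖ ≤ ε / 8 := by
    intro ω hω
    simpa [hω.1] using hc ω hω
  refine ⟨f, hf, fun n φ hφ ψ hψ i j => ?_⟩
  have h1 := norm_entry_le hφ key i j
  have h2 := norm_entry_le hψ key i j
  simp only [map_sub, map_smul, hφ.1, hψ.1, Matrix.sub_apply] at h1 h2
  have hsplit : φ b i j - ψ b i j = (φ f i j - ψ f i j) +
      ((φ b i j - φ f i j - (c • (1 : Matrix (Fin n) (Fin n) ℂ)) i j) -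
        (ψ b i j - ψ f i j - (c • (1 : Matrix (Fin n) (Fin n) ℂ)) i j)) := by ring
  rw [hsplit]
  refine (norm_add_le _ _).trans (add_le_add le_rfl ?_)
  refine (norm_sub_le _ _).trans ?_
  linarith

theorem exists_forall_norm_entry_sub_le
    (hTB : TotallyBoundedModScalars (posStates ℂ V.one V.posSet) {b | L 1 (oneMat b) ≤ 1}) :
    ∃ C : ℝ, 0 ≤ C ∧ ∀ n, ∀ φ ∈ CS V n, ∀ ψ ∈ CS V n, ∀ b, L 1 (oneMat b) ≤ 1 → ∀ i j,
      ‖φ b i j - ψ b i j‖ ≤ C := by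
  obtain ⟨F, hF, hB⟩ := exists_finite_entry_sub_le hTB one_pos
  choose R hR0 hR using V.isOrderBounding.exists_norm_le
  obtain ⟨M, hM⟩ := (hF.image R).bddAbove
  refine ⟨max (8 * M + 1) 0, le_max_right _ _, fun n φ hφ ψ hψ b hb i j => ?_⟩
  obtain ⟨f, hf, h⟩ := hB b hb
  have h1 := norm_entry_le hφ (hR f) i j
  have h2 := norm_entry_le hψ (hR f) i j
  have h3 := h n φ hφ ψ hψ i j
  have h4 := norm_sub_le (φ f i j) (ψ f i j)
  have h5 := hM ⟨f, hf, rfl⟩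
  exact le_max_of_le_left (by linarith)

theorem bddAbove_Dmet (hL : IsMatrixLipschitzSeminorm V L)
    (hTB : TotallyBoundedModScalars (posStates ℂ V.one V.posSet) {b | L 1 (oneMat b) ≤ 1})
    {φ ψ : MState V n} (hφ : φ ∈ CS V n) (hψ : ψ ∈ CS V n) :
    BddAbove {x | ∃ (r : ℕ) (a : Matrix (Fin r) (Fin r) V.carrier), L r a ≤ 1 ∧
      x = scalarOpNorm (mpair φ a - mpair ψ a)} := by
  obtain ⟨C, hC, h⟩ := exists_forall_norm_entry_sub_le hTB
  refine ⟨(n : ℝ) ^ 2 * C, ?_⟩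
  rintro _ ⟨r, a, ha, rfl⟩
  refine (scalarOpNorm_mpair_sub_le hL hφ.1 hψ.1 hC (h n φ hφ ψ hψ) a).trans ?_
  exact mul_le_of_le_one_right (by positivity) ha

theorem norm_entry_sub_le_Dmet_mul (hL : IsMatrixLipschitzSeminorm V L)
    (hTB : TotallyBoundedModScalars (posStates ℂ V.one V.posSet) {b | L 1 (oneMat b) ≤ 1})
    {φ ψ : MState V n} (hφ : φ ∈ CS V n) (hψ : ψ ∈ CS V n) (b : V.carrier) (i j : Fin n) :
    ‖φ b i j - ψ b i j‖ ≤ Dmet V L n φ ψ * L 1 (oneMat b) := by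
  refine norm_entry_sub_le hL hφ.1 hψ.1 (fun b hb => ?_) b
  refine le_trans ?_ (le_csSup (bddAbove_Dmet hL hTB hφ hψ) ⟨1, oneMat b, hb, rfl⟩)
  exact norm_entry_le_scalarOpNorm (mpair φ (oneMat b) - mpair ψ (oneMat b)) (0, i) (0, j)

theorem isMatrixLipNorm_of_totallyBoundedModScalars (hL : IsMatrixLipschitzSeminorm V L)
    (hTB : TotallyBoundedModScalars (posStates ℂ V.one V.posSet) {b | L 1 (oneMat b) ≤ 1}) :
    IsMatrixLipNorm V L where
  toIsMatrixLipschitzSeminorm := hL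
  top_eq n := by
    rw [BWtop_eq_induced]
    refine generateFrom_balls_eq_induced
      (fun (φ : {φ : MState V n // φ ∈ CS V n}) v i j => φ.1 v i j)
      (fun φ ψ => Dmet V L n φ.1 ψ.1) (fun φ => ?_) (fun φ ψ => Dmet_nonneg _ _)
      (fun φ ψ κ => ?_) (fun v => ?_) (fun ε hε => ?_)
    · refine le_antisymm (Real.sSup_le ?_ le_rfl) (Dmet_nonneg _ _)
      rintro _ ⟨r, a, -, rfl⟩
      rw [sub_self, scalarOpNorm_zero]
    · refine Real.sSup_le ?_ (add_nonneg (Dmet_nonneg _ _) (Dmet_nonneg _ _))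
      rintro _ ⟨r, a, ha, rfl⟩
      rw [← sub_add_sub_cancel _ (mpair ψ.1 a)]
      exact (scalarOpNorm_add_le _ _).trans (add_le_add
        (le_csSup (bddAbove_Dmet hL hTB φ.2 ψ.2) ⟨r, a, ha, rfl⟩)
        (le_csSup (bddAbove_Dmet hL hTB ψ.2 κ.2) ⟨r, a, ha, rfl⟩))
    · refine ⟨L 1 (oneMat v), fun φ ψ => ?_⟩
      have h0 := mul_nonneg (hL.nonneg 1 (oneMat v)) (Dmet_nonneg (L := L) φ.1 ψ.1)
      refine (pi_norm_le_iff_of_nonneg h0).2 fun i => (pi_norm_le_iff_of_nonneg h0).2 fun j => ?_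
      rw [mul_comm]
      exact norm_entry_sub_le_Dmet_mul hL hTB φ.2 ψ.2 v i j
    · set δ := ε / (4 * ((n : ℝ) ^ 2 + 1)) with hδdef
      have hδ : 0 < δ := by positivity
      obtain ⟨F, hF, hB⟩ := exists_finite_entry_sub_le hTB hδ
      refine ⟨F, hF, δ, hδ, fun φ ψ h => ?_⟩
      have h1 : Dmet V L n φ.1 ψ.1 ≤ (n : ℝ) ^ 2 * (δ + δ) := by
        refine Dmet_le hL φ.2.1 ψ.2.1 (by positivity) fun b hb i j => ?_
        obtain ⟨f, hf, hbf⟩ := hB b hb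
        refine (hbf n _ φ.2 _ ψ.2 i j).trans (add_le_add ?_ le_rfl)
        refine le_trans ?_ (h f hf).le
        exact (norm_le_pi_norm (fun j => φ.1 f i j - ψ.1 f i j) j).trans
          (norm_le_pi_norm (fun i j => φ.1 f i j - ψ.1 f i j) i)
      refine h1.trans_lt ?_
      have h2 : 4 * ((n : ℝ) ^ 2 + 1) * δ = ε := by
        rw [hδdef]
        field_simp
      nlinarith [sq_nonneg (n : ℝ)]

end MatrixLipschitz

/-! ### Direct sums -/

section Prod

open Matrix

section MapMat

variable {V W : Type} [AddCommGroup V] [AddCommGroup W] [Module ℂ V] [Module ℂ W]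
  (f : V →ₗ[ℂ] W) {m n : ℕ}

theorem mapMat_add (a b : Matrix (Fin n) (Fin n) V) :
    mapMat f (a + b) = mapMat f a + mapMat f b :=
  Matrix.ext fun i j => map_add f (a i j) (b i j)

theorem mapMat_smul (c : ℂ) (a : Matrix (Fin n) (Fin n) V) :
    mapMat f (c • a) = c • mapMat f a :=
  Matrix.ext fun i j => map_smul f c (a i j)

theorem mapMat_dsumMat (a : Matrix (Fin m) (Fin m) V) (b : Matrix (Fin n) (Fin n) V) :
    mapMat f (dsumMat a b) = dsumMat (mapMat f a) (mapMat f b) := by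
  ext i j
  simp only [mapMat, dsumMat, reindex_apply, submatrix_apply, of_apply]
  rcases finSumFinEquiv.symm i with i | i <;> rcases finSumFinEquiv.symm j with j | j <;> simp

theorem mapMat_mmulMat (α : Matrix (Fin n) (Fin m) ℂ) (a : Matrix (Fin m) (Fin m) V)
    (β : Matrix (Fin m) (Fin n) ℂ) :
    mapMat f (mmulMat α a β) = mmulMat α (mapMat f a) β := by
  ext i j
  simp [mapMat, mmulMat]

theorem mapMat_conjTranspose [Star V] [Star W] (hf : ∀ v, f (star v) = star (f v))
    (a : Matrix (Fin n) (Fin n) V) : mapMat f aᴴ = (mapMat f a)ᴴ :=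
  Matrix.ext fun i j => hf (a j i)

theorem mmulMat_eq_mul (α : Matrix (Fin n) (Fin m) ℂ) (a : Matrix (Fin m) (Fin m) ℂ)
    (β : Matrix (Fin m) (Fin n) ℂ) : mmulMat α a β = α * a * β := by
  ext i j
  simp only [mmulMat, of_apply, mul_apply, Finset.sum_mul, smul_eq_mul]
  rw [Finset.sum_comm]
  refine Finset.sum_congr rfl fun k _ => Finset.sum_congr rfl fun l _ => ?_
  ring

end MapMat

variable {V₁ V₂ : MOUS} {n : ℕ}

theorem comp_fstL_mem {φ : MState V₁ n} (hφ : φ ∈ CS V₁ n) :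
    φ.comp (fstL V₁ V₂) ∈ CS (V₁.prod V₂) n :=
  ⟨hφ.1, fun r _ hv => hφ.2 r _ hv.1⟩

theorem comp_sndL_mem {ψ : MState V₂ n} (hψ : ψ ∈ CS V₂ n) :
    ψ.comp (sndL V₁ V₂) ∈ CS (V₁.prod V₂) n :=
  ⟨hψ.1, fun r _ hv => hψ.2 r _ hv.2⟩

/-- The difference of two functionals on the summands, as a functional on the direct sum. -/
def bridge (ω₁ : V₁.carrier →ₗ[ℂ] ℂ) (ω₂ : V₂.carrier →ₗ[ℂ] ℂ) :
    (V₁.prod V₂).carrier →ₗ[ℂ] ℂ :=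
  ω₁ ∘ₗ fstL V₁ V₂ - ω₂ ∘ₗ sndL V₁ V₂

theorem bridge_apply (ω₁ : V₁.carrier →ₗ[ℂ] ℂ) (ω₂ : V₂.carrier →ₗ[ℂ] ℂ)
    (p : (V₁.prod V₂).carrier) : bridge ω₁ ω₂ p = ω₁ p.1 - ω₂ p.2 := rfl

/-- The matrix seminorm on the direct sum obtained by adding the bridge `ω₁ - ω₂`. -/
def bridgeSeminorm (L₁ : ∀ n : ℕ, Matrix (Fin n) (Fin n) V₁.carrier → ℝ)
    (L₂ : ∀ n : ℕ, Matrix (Fin n) (Fin n) V₂.carrier → ℝ)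
    (ω₁ : V₁.carrier →ₗ[ℂ] ℂ) (ω₂ : V₂.carrier →ₗ[ℂ] ℂ) (n : ℕ)
    (p : Matrix (Fin n) (Fin n) (V₁.prod V₂).carrier) : ℝ :=
  max (L₁ n (mapMat (fstL V₁ V₂) p)) (max (L₂ n (mapMat (sndL V₁ V₂) p))
    (scalarOpNorm (mapMat (bridge ω₁ ω₂) p)))

variable {L₁ : ∀ n : ℕ, Matrix (Fin n) (Fin n) V₁.carrier → ℝ}
  {L₂ : ∀ n : ℕ, Matrix (Fin n) (Fin n) V₂.carrier → ℝ}
  {ω₁ : V₁.carrier →ₗ[ℂ] ℂ} {ω₂ : V₂.carrier →ₗ[ℂ] ℂ}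

theorem isMatrixLipschitzSeminorm_bridgeSeminorm (h₁ : IsMatrixLipschitzSeminorm V₁ L₁)
    (h₂ : IsMatrixLipschitzSeminorm V₂ L₂) (hω₁ : ω₁ ∈ posStates ℂ V₁.one V₁.posSet)
    (hω₂ : ω₂ ∈ posStates ℂ V₂.one V₂.posSet) :
    IsMatrixLipschitzSeminorm (V₁.prod V₂) (bridgeSeminorm L₁ L₂ ω₁ ω₂) where
  nonneg n v := le_max_of_le_left (h₁.nonneg _ _)
  add_le n v w := by
    simp only [bridgeSeminorm, mapMat_add]
    refine max_le ?_ (max_le ?_ ?_)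
    · exact (h₁.add_le _ _ _).trans (add_le_add (le_max_left _ _) (le_max_left _ _))
    · exact (h₂.add_le _ _ _).trans (add_le_add
        (le_max_of_le_right (le_max_left _ _)) (le_max_of_le_right (le_max_left _ _)))
    · exact (scalarOpNorm_add_le _ _).trans (add_le_add
        (le_max_of_le_right (le_max_right _ _)) (le_max_of_le_right (le_max_right _ _)))
  smul_eq n c v := by
    simp only [bridgeSeminorm, mapMat_smul, h₁.smul_eq, h₂.smul_eq, scalarOpNorm_smul,
      mul_max_of_nonneg _ _ (norm_nonneg c)]
  null_iff n v := by
    constructor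
    · intro h
      have e1 : L₁ n (mapMat (fstL V₁ V₂) v) = 0 :=
        le_antisymm ((le_max_left _ _).trans h.le) (h₁.nonneg _ _)
      have e2 : L₂ n (mapMat (sndL V₁ V₂) v) = 0 :=
        le_antisymm ((le_max_of_le_right (le_max_left _ _)).trans h.le) (h₂.nonneg _ _)
      have e3 : scalarOpNorm (mapMat (bridge ω₁ ω₂) v) = 0 :=
        le_antisymm ((le_max_of_le_right (le_max_right _ _)).trans h.le) (scalarOpNorm_nonneg _)
      obtain ⟨c, hc⟩ := (h₁.null_iff _ _).1 e1
      obtain ⟨d, hd⟩ := (h₂.null_iff _ _).1 e2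
      refine ⟨c, Matrix.ext fun i j => ?_⟩
      have f1 : (v i j).1 = c i j • V₁.one := congrFun (congrFun hc i) j
      have f2 : (v i j).2 = d i j • V₂.one := congrFun (congrFun hd i) j
      have f3 : ω₁ (v i j).1 - ω₂ (v i j).2 = 0 :=
        congrFun (congrFun (eq_zero_of_scalarOpNorm_eq_zero e3) i) j
      rw [f1, f2, map_smul, map_smul, hω₁.1, hω₂.1, smul_eq_mul, smul_eq_mul, mul_one, mul_one,
        sub_eq_zero] at f3
      exact Prod.ext f1 (by rw [f2, ← f3]; rfl)
    · rintro ⟨c, rfl⟩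
      have e1 := (h₁.null_iff n _).2 ⟨c, rfl⟩
      have e2 := (h₂.null_iff n _).2 ⟨c, rfl⟩
      have e3 : mapMat (bridge ω₁ ω₂) (Matrix.of fun i j => c i j • (V₁.prod V₂).one) = 0 := by
        ext i j
        change ω₁ (c i j • V₁.one) - ω₂ (c i j • V₂.one) = 0
        rw [map_smul, map_smul, hω₁.1, hω₂.1, sub_self]
      refine le_antisymm (max_le e1.le (max_le e2.le ?_)) (le_max_of_le_left (h₁.nonneg _ _))
      rw [e3, scalarOpNorm_zero]
  dsum_eq m n v w := by
    simp only [bridgeSeminorm, mapMat_dsumMat, h₁.dsum_eq, h₂.dsum_eq, scalarOpNorm_dsumMat]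
    rw [max_max_max_comm (L₂ m _), max_max_max_comm (L₁ m _)]
  mmul_le m n α v β := by
    have hα := scalarOpNorm_nonneg α
    have hβ := scalarOpNorm_nonneg β
    simp only [bridgeSeminorm, mapMat_mmulMat]
    refine max_le ?_ (max_le ?_ ?_)
    · refine (h₁.mmul_le _ _ _ _ _).trans ?_
      gcongr
      exact le_max_left _ _
    · refine (h₂.mmul_le _ _ _ _ _).trans ?_
      gcongr
      exact le_max_of_le_right (le_max_left _ _)
    · rw [mmulMat_eq_mul]
      refine (scalarOpNorm_mul_le _ _).trans
        ((mul_le_mul_of_nonneg_right (scalarOpNorm_mul_le _ _) hβ).trans ?_)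
      gcongr
      exact le_max_of_le_right (le_max_right _ _)
  star_eq n v := by
    have e1 : mapMat (fstL V₁ V₂) vᴴ = (mapMat (fstL V₁ V₂) v)ᴴ := rfl
    have e2 : mapMat (sndL V₁ V₂) vᴴ = (mapMat (sndL V₁ V₂) v)ᴴ := rfl
    have e3 : mapMat (bridge ω₁ ω₂) vᴴ = (mapMat (bridge ω₁ ω₂) v)ᴴ := by
      refine mapMat_conjTranspose _ (fun p => ?_) v
      rw [bridge_apply, bridge_apply, star_sub, ← MOUS.map_star_of_isPosFunctional hω₁.2,
        ← MOUS.map_star_of_isPosFunctional hω₂.2]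
      rfl
    simp only [bridgeSeminorm, e1, e2, e3, h₁.star_eq, h₂.star_eq, scalarOpNorm_conjTranspose]

theorem isMatrixLipNorm_bridgeSeminorm (h₁ : IsMatrixLipNorm V₁ L₁)
    (h₂ : IsMatrixLipNorm V₂ L₂) (hω₁ : ω₁ ∈ posStates ℂ V₁.one V₁.posSet)
    (hω₂ : ω₂ ∈ posStates ℂ V₂.one V₂.posSet) :
    IsMatrixLipNorm (V₁.prod V₂) (bridgeSeminorm L₁ L₂ ω₁ ω₂) := by
  refine isMatrixLipNorm_of_totallyBoundedModScalars
    (isMatrixLipschitzSeminorm_bridgeSeminorm h₁.1 h₂.1 hω₁ hω₂) ?_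
  refine (TotallyBoundedModScalars.prod V₁.isOrderBounding V₂.isOrderBounding
    (totallyBoundedModScalars_of_isMatrixLipNorm h₁)
    (totallyBoundedModScalars_of_isMatrixLipNorm h₂) hω₁ hω₂ 1).mono ?_
  intro p hp
  have hp' : bridgeSeminorm L₁ L₂ ω₁ ω₂ 1 (oneMat p) ≤ 1 := hp
  obtain ⟨hp₁, hp₂⟩ := max_le_iff.1 hp'
  obtain ⟨hp₂, hp₃⟩ := max_le_iff.1 hp₂
  exact ⟨hp₁, hp₂, (norm_entry_le_scalarOpNorm
    (mapMat (bridge ω₁ ω₂) (oneMat p)) 0 0).trans hp₃⟩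

theorem induces_fstL_bridgeSeminorm (h₁ : IsMatrixLipschitzSeminorm V₁ L₁)
    (h₂ : IsMatrixLipschitzSeminorm V₂ L₂) (hω₂ : ω₂ V₂.one = 1) :
    Induces (V₁.prod V₂) V₁ (fstL V₁ V₂) (bridgeSeminorm L₁ L₂ ω₁ ω₂) L₁ := by
  intro n b
  refine (IsLeast.csInf_eq ⟨?_, ?_⟩).symm
  · refine ⟨Matrix.of fun i j => (b i j, ω₁ (b i j) • V₂.one), rfl, ?_⟩
    refine (max_eq_left (max_le ?_ ?_)).symm
    · exact ((h₂.null_iff n _).2 ⟨Matrix.of fun i j => ω₁ (b i j), rfl⟩).le.trans (h₁.nonneg _ _)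
    · have e : mapMat (bridge ω₁ ω₂)
          (Matrix.of fun i j => ((b i j, ω₁ (b i j) • V₂.one) : (V₁.prod V₂).carrier)) = 0 := by
        ext i j
        change ω₁ (b i j) - ω₂ (ω₁ (b i j) • V₂.one) = 0
        rw [map_smul, hω₂, smul_eq_mul, mul_one, sub_self]
      rw [e, scalarOpNorm_zero]
      exact h₁.nonneg _ _
  · rintro _ ⟨p, rfl, rfl⟩
    exact le_max_left _ _

theorem induces_sndL_bridgeSeminorm (h₁ : IsMatrixLipschitzSeminorm V₁ L₁)
    (h₂ : IsMatrixLipschitzSeminorm V₂ L₂) (hω₁ : ω₁ V₁.one = 1) :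
    Induces (V₁.prod V₂) V₂ (sndL V₁ V₂) (bridgeSeminorm L₁ L₂ ω₁ ω₂) L₂ := by
  intro n b
  refine (IsLeast.csInf_eq ⟨?_, ?_⟩).symm
  · refine ⟨Matrix.of fun i j => (ω₂ (b i j) • V₁.one, b i j), rfl, ?_⟩
    refine ((max_eq_right ?_).trans (max_eq_left ?_)).symm
    · exact le_max_of_le_left
        (((h₁.null_iff n _).2 ⟨Matrix.of fun i j => ω₂ (b i j), rfl⟩).le.trans (h₂.nonneg _ _))
    · have e : mapMat (bridge ω₁ ω₂)
          (Matrix.of fun i j => ((ω₂ (b i j) • V₁.one, b i j) : (V₁.prod V₂).carrier)) = 0 := by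
        ext i j
        change ω₁ (ω₂ (b i j) • V₁.one) - ω₂ (b i j) = 0
        rw [map_smul, hω₁, smul_eq_mul, mul_one, sub_self]
      rw [e, scalarOpNorm_zero]
      exact h₂.nonneg _ _
  · rintro _ ⟨p, rfl, rfl⟩
    exact le_max_of_le_right (le_max_left _ _)

theorem MSet_nonempty (h₁ : IsMatrixLipNorm V₁ L₁) (h₂ : IsMatrixLipNorm V₂ L₂)
    (hV₁ : (CS V₁ 1).Nonempty) (hV₂ : (CS V₂ 1).Nonempty) : (MSet V₁ L₁ V₂ L₂).Nonempty := by
  obtain ⟨φ, hφ⟩ := hV₁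
  obtain ⟨ψ, hψ⟩ := hV₂
  have hφ' := entryFunctional_mem_posStates hφ
  have hψ' := entryFunctional_mem_posStates hψ
  exact ⟨_, isMatrixLipNorm_bridgeSeminorm h₁ h₂ hφ' hψ',
    induces_fstL_bridgeSeminorm h₁.1 h₂.1 hψ'.1, induces_sndL_bridgeSeminorm h₁.1 h₂.1 hφ'.1⟩

end Prod

/-! ### Gluing Lip-norms on order unit spaces -/

section HausdorffDist

variable {X : Type} {d : X → X → ℝ} {s t : Set X} {C : ℝ}

theorem hDist_flip (d : X → X → ℝ) (s t : Set X) : hDist (flip d) t s = hDist d s t :=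
  max_comm _ _

theorem hDist_nonneg (hd : ∀ x y, 0 ≤ d x y) : 0 ≤ hDist d s t := by
  refine le_max_of_le_left (Real.sSup_nonneg ?_)
  rintro _ ⟨x, -, rfl⟩
  refine Real.sInf_nonneg ?_
  rintro _ ⟨y, -, rfl⟩
  exact hd x y

theorem sSup_image_sInf_image_le (hd : ∀ x y, 0 ≤ d x y) (hC : 0 ≤ C)
    (h : ∀ x ∈ s, ∃ y ∈ t, d x y ≤ C) :
    sSup ((fun x => sInf ((fun y => d x y) '' t)) '' s) ≤ C := by
  refine Real.sSup_le ?_ hC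
  rintro _ ⟨x, hx, rfl⟩
  obtain ⟨y, hy, hxy⟩ := h x hx
  refine (csInf_le ⟨0, ?_⟩ (Set.mem_image_of_mem _ hy)).trans hxy
  rintro _ ⟨z, -, rfl⟩
  exact hd x z

theorem hDist_le (hd : ∀ x y, 0 ≤ d x y) (hC : 0 ≤ C) (h₁ : ∀ x ∈ s, ∃ y ∈ t, d x y ≤ C)
    (h₂ : ∀ y ∈ t, ∃ x ∈ s, d x y ≤ C) : hDist d s t ≤ C :=
  max_le (sSup_image_sInf_image_le hd hC h₁)
    (sSup_image_sInf_image_le (d := flip d) (fun x y => hd y x) hC h₂)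

theorem exists_lt_of_hDist_lt (hd : ∀ x y, 0 ≤ d x y) {K : ℝ}
    (hK : ∀ x ∈ s, ∀ y ∈ t, d x y ≤ K) (ht : t.Nonempty) (h : hDist d s t < C) {x : X}
    (hx : x ∈ s) : ∃ y ∈ t, d x y < C := by
  have hbdd : BddAbove ((fun x => sInf ((fun y => d x y) '' t)) '' s) := by
    refine ⟨K, ?_⟩
    rintro _ ⟨x, hx, rfl⟩
    obtain ⟨y, hy⟩ := ht
    refine (csInf_le ⟨0, ?_⟩ (Set.mem_image_of_mem _ hy)).trans (hK x hx y hy)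
    rintro _ ⟨z, -, rfl⟩
    exact hd x z
  obtain ⟨_, ⟨y, hy, rfl⟩, hxy⟩ := exists_lt_of_csInf_lt (ht.image fun y => d x y)
    (((le_csSup hbdd ⟨x, hx, rfl⟩).trans (le_max_left _ _)).trans_lt h)
  exact ⟨y, hy, hxy⟩

end HausdorffDist

namespace OUS

variable {A B : OUS} {LA : A.carrier → ℝ} {LB : B.carrier → ℝ} {I : Type}
  {μ : I → A.carrier →ₗ[ℝ] ℝ} {ν : I → B.carrier →ₗ[ℝ] ℝ} {r : I → ℝ} {ε : ℝ}

/-- The least `c` such that `|μ i a - ν i b| ≤ c * r i` for all `i`. -/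
def glueGauge (μ : I → A.carrier →ₗ[ℝ] ℝ) (ν : I → B.carrier →ₗ[ℝ] ℝ) (r : I → ℝ)
    (p : (A.prod B).carrier) : ℝ :=
  ⨆ i, |μ i p.1 - ν i p.2| / r i

/-- The seminorm on the direct sum for which the states `μ i` and `ν i` have distance at
most `r i`. -/
def glueNorm (LA : A.carrier → ℝ) (LB : B.carrier → ℝ) (μ : I → A.carrier →ₗ[ℝ] ℝ)
    (ν : I → B.carrier →ₗ[ℝ] ℝ) (r : I → ℝ) (p : (A.prod B).carrier) : ℝ :=
  max (LA p.1) (max (LB p.2) (glueGauge μ ν r p))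

theorem glueGauge_nonneg (hε : 0 < ε) (hr : ∀ i, ε ≤ r i) (p : (A.prod B).carrier) :
    0 ≤ glueGauge μ ν r p :=
  Real.iSup_nonneg fun i => div_nonneg (abs_nonneg _) (hε.le.trans (hr i))

theorem glueGauge_le (hε : 0 < ε) (hr : ∀ i, ε ≤ r i) {p : (A.prod B).carrier} {c : ℝ}
    (hc : 0 ≤ c) (h : ∀ i, |μ i p.1 - ν i p.2| ≤ c * r i) : glueGauge μ ν r p ≤ c :=
  Real.iSup_le (fun i => (div_le_iff₀ (hε.trans_le (hr i))).2 (h i)) hc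

theorem bddAbove_range_glueGauge (hμ : ∀ i, μ i ∈ States A) (hν : ∀ i, ν i ∈ States B)
    (hε : 0 < ε) (hr : ∀ i, ε ≤ r i) (p : (A.prod B).carrier) :
    BddAbove (Set.range fun i => |μ i p.1 - ν i p.2| / r i) := by
  obtain ⟨R, -, hR⟩ := A.isOrderBounding.exists_norm_le p.1
  obtain ⟨R', -, hR'⟩ := B.isOrderBounding.exists_norm_le p.2
  rw [← states_eq_posStates] at hR hR'
  refine ⟨(R + R') / ε, ?_⟩
  rintro _ ⟨i, rfl⟩
  have h : |μ i p.1 - ν i p.2| ≤ R + R' :=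
    (abs_sub _ _).trans (add_le_add (hR _ (hμ i)) (hR' _ (hν i)))
  exact div_le_div₀ ((abs_nonneg _).trans h) h hε (hr i)

theorem abs_sub_le_glueGauge_mul (hμ : ∀ i, μ i ∈ States A) (hν : ∀ i, ν i ∈ States B)
    (hε : 0 < ε) (hr : ∀ i, ε ≤ r i) (p : (A.prod B).carrier) (i : I) :
    |μ i p.1 - ν i p.2| ≤ glueGauge μ ν r p * r i :=
  (div_le_iff₀ (hε.trans_le (hr i))).1
    (le_ciSup (bddAbove_range_glueGauge hμ hν hε hr p) i)

theorem isLipNormOUS_glueNorm [Nonempty I] (hA : IsLipNormOUS A LA) (hB : IsLipNormOUS B LB)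
    (hμ : ∀ i, μ i ∈ States A) (hν : ∀ i, ν i ∈ States B) (hε : 0 < ε) (hr : ∀ i, ε ≤ r i) :
    IsLipNormOUS (A.prod B) (glueNorm LA LB μ ν r) := by
  have smul_eq : ∀ (t : ℝ) p, glueNorm LA LB μ ν r (t • p) = |t| * glueNorm LA LB μ ν r p := by
    intro t p
    have h : glueGauge μ ν r (t • p) = |t| * glueGauge μ ν r p := by
      rw [glueGauge, glueGauge, Real.mul_iSup_of_nonneg (abs_nonneg t)]
      refine iSup_congr fun i => ?_
      change |μ i (t • p.1) - ν i (t • p.2)| / r i = _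
      rw [map_smul, map_smul, ← smul_sub, smul_eq_mul, abs_mul, mul_div_assoc]
    have h₁ : LA (t • p).1 = |t| * LA p.1 := hA.smul_eq t p.1
    have h₂ : LB (t • p).2 = |t| * LB p.2 := hB.smul_eq t p.2
    rw [glueNorm, glueNorm, h, h₁, h₂, mul_max_of_nonneg _ _ (abs_nonneg t),
      mul_max_of_nonneg _ _ (abs_nonneg t)]
  have nonneg : ∀ p, 0 ≤ glueNorm LA LB μ ν r p := fun p => le_max_of_le_left (hA.nonneg _)
  have null_iff : ∀ p, glueNorm LA LB μ ν r p = 0 ↔ ∃ t : ℝ, p = t • (A.prod B).one := by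
    intro p
    constructor
    · intro hp
      obtain ⟨h₁, h₂⟩ := max_le_iff.1 hp.le
      obtain ⟨h₂, h₃⟩ := max_le_iff.1 h₂
      obtain ⟨s, hs⟩ := (hA.null_iff _).1 (h₁.antisymm (hA.nonneg _))
      obtain ⟨t, ht⟩ := (hB.null_iff _).1 (h₂.antisymm (hB.nonneg _))
      obtain ⟨i⟩ := ‹Nonempty I›
      have h := abs_sub_le_glueGauge_mul hμ hν hε hr p i
      have h' : |μ i p.1 - ν i p.2| ≤ 0 :=
        h.trans (mul_nonpos_of_nonpos_of_nonneg h₃ (hε.le.trans (hr i)))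
      rw [hs, ht, map_smul, map_smul, (hμ i).1, (hν i).1, smul_eq_mul, smul_eq_mul, mul_one,
        mul_one] at h'
      have hst : s = t := sub_eq_zero.1 (abs_nonpos_iff.1 h')
      exact ⟨s, Prod.ext hs (hst ▸ ht)⟩
    · rintro ⟨t, rfl⟩
      refine le_antisymm (max_le ?_ (max_le ?_ ?_)) (nonneg _)
      · exact ((hA.null_iff _).2 ⟨t, rfl⟩).le
      · exact ((hB.null_iff _).2 ⟨t, rfl⟩).le
      · refine glueGauge_le hε hr le_rfl fun i => ?_
        change |μ i (t • A.one) - ν i (t • B.one)| ≤ _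
        simp [(hμ i).1, (hν i).1]
  refine ⟨nonneg, fun p q => ?_, smul_eq, null_iff, ?_⟩
  · refine max_le ?_ (max_le ?_ ?_)
    · exact (hA.add_le _ _).trans (add_le_add (le_max_left _ _) (le_max_left _ _))
    · exact (hB.add_le _ _).trans (add_le_add (le_max_of_le_right (le_max_left _ _))
        (le_max_of_le_right (le_max_left _ _)))
    · refine (glueGauge_le hε hr (add_nonneg (glueGauge_nonneg (μ := μ) (ν := ν) hε hr p)
        (glueGauge_nonneg hε hr q)) fun i => ?_).trans
        (add_le_add (le_max_of_le_right (le_max_right _ _))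
          (le_max_of_le_right (le_max_right _ _)))
      change |μ i (p.1 + q.1) - ν i (p.2 + q.2)| ≤ _
      rw [map_add, map_add, add_sub_add_comm, add_mul]
      exact (abs_add_le _ _).trans (add_le_add (abs_sub_le_glueGauge_mul hμ hν hε hr p i)
        (abs_sub_le_glueGauge_mul hμ hν hε hr q i))
  · obtain ⟨i⟩ := ‹Nonempty I›
    refine rhoTop_eq_wTop nonneg smul_eq (fun p => (null_iff p).1) ?_
    have hμi := hμ i
    have hνi := hν i
    rw [states_eq_posStates] at hμi hνi
    refine (TotallyBoundedModScalars.prod A.isOrderBounding B.isOrderBounding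
      (totallyBoundedModScalars_of_isLipNormOUS hA)
      (totallyBoundedModScalars_of_isLipNormOUS hB) hμi hνi (r i)).mono ?_
    intro p hp
    have hp' : glueNorm LA LB μ ν r p ≤ 1 := hp
    obtain ⟨h₁, h₂⟩ := max_le_iff.1 hp'
    obtain ⟨h₂, h₃⟩ := max_le_iff.1 h₂
    exact ⟨h₁, h₂, (abs_sub_le_glueGauge_mul hμ hν hε hr p i).trans
      (mul_le_of_le_one_left (hε.le.trans (hr i)) h₃)⟩

theorem rhoL_glueNorm_le (hμ : ∀ i, μ i ∈ States A) (hν : ∀ i, ν i ∈ States B)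
    (hε : 0 < ε) (hr : ∀ i, ε ≤ r i) (i : I) :
    rhoL (A.prod B) (glueNorm LA LB μ ν r)
      ((μ i).comp (LinearMap.fst ℝ A.carrier B.carrier))
      ((ν i).comp (LinearMap.snd ℝ A.carrier B.carrier)) ≤ r i := by
  have hri := hε.le.trans (hr i)
  refine Real.sSup_le ?_ hri
  rintro _ ⟨p, hp, rfl⟩
  exact (abs_sub_le_glueGauge_mul hμ hν hε hr p i).trans
    (mul_le_of_le_one_left hri ((max_le_iff.1 (max_le_iff.1 hp).2).2))

/-- An element that is Lipschitz for the metric of the state space is approximated by elements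
whose Lip-norm is controlled, keeping the distance to prescribed values under control. -/
theorem exists_lt_forall_abs_sub_le_mul (hne : (States B).Nonempty) (hB : IsLipNormOUS B LB)
    (hν : ∀ i, ν i ∈ States B) (hε : 0 < ε) (hr : ∀ i, ε ≤ r i) {x : B.carrier} {c : I → ℝ}
    {κ κ' : ℝ} (hκ : 0 ≤ κ) (hκ' : κ < κ')
    (hx : ∀ ω ∈ States B, ∀ ω' ∈ States B, |ω x - ω' x| ≤ κ * rhoL B LB ω ω')
    (hc : ∀ i, |c i - ν i x| ≤ κ * r i) :
    ∃ b, LB b < κ' ∧ ∀ i, |c i - ν i b| ≤ κ' * r i := by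
  have hη : 0 < (κ' - κ) * ε := mul_pos (sub_pos.2 hκ') hε
  obtain ⟨b, hb, hb'⟩ := exists_lt_forall_abs_sub_le hne hB hκ hκ' hη hx
  refine ⟨b, hb, fun i => ?_⟩
  have h₁ := abs_sub_le (c i) (ν i x) (ν i b)
  have h₂ := hb' (ν i) (hν i)
  rw [abs_sub_comm] at h₂
  have h₃ := mul_le_mul_of_nonneg_left (hr i) (sub_pos.2 hκ').le
  linarith [hc i]

theorem inducesOUS_fst_glueNorm (hA : ∀ a, 0 ≤ LA a) (hε : 0 < ε) (hr : ∀ i, ε ≤ r i)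
    (h : ∀ a κ, LA a < κ → ∃ b, LB b < κ ∧ ∀ i, |μ i a - ν i b| ≤ κ * r i) :
    InducesOUS (A.prod B) A (LinearMap.fst ℝ A.carrier B.carrier) (glueNorm LA LB μ ν r) LA := by
  intro a
  symm
  refine csInf_eq_of_forall_ge_of_forall_gt_exists_lt ⟨_, (a, 0), rfl, rfl⟩ ?_ ?_
  · rintro _ ⟨p, rfl, rfl⟩
    exact le_max_left _ _
  · intro w hw
    obtain ⟨κ, hκ, hκw⟩ := exists_between hw
    obtain ⟨b, hb, hb'⟩ := h a κ hκ
    refine ⟨_, ⟨(a, b), rfl, rfl⟩, lt_of_le_of_lt (max_le hκ.le (max_le hb.le ?_)) hκw⟩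
    exact glueGauge_le hε hr ((hA a).trans hκ.le) hb'

theorem inducesOUS_snd_glueNorm (hB : ∀ b, 0 ≤ LB b) (hε : 0 < ε) (hr : ∀ i, ε ≤ r i)
    (h : ∀ b κ, LB b < κ → ∃ a, LA a < κ ∧ ∀ i, |ν i b - μ i a| ≤ κ * r i) :
    InducesOUS (A.prod B) B (LinearMap.snd ℝ A.carrier B.carrier) (glueNorm LA LB μ ν r) LB := by
  intro b
  symm
  refine csInf_eq_of_forall_ge_of_forall_gt_exists_lt ⟨_, (0, b), rfl, rfl⟩ ?_ ?_
  · rintro _ ⟨p, rfl, rfl⟩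
    exact le_max_of_le_right (le_max_left _ _)
  · intro w hw
    obtain ⟨κ, hκ, hκw⟩ := exists_between hw
    obtain ⟨a, ha, ha'⟩ := h b κ hκ
    refine ⟨_, ⟨(a, b), rfl, rfl⟩, lt_of_le_of_lt (max_le ha.le (max_le hκ.le ?_)) hκw⟩
    exact glueGauge_le hε hr ((hB b).trans hκ.le) fun i => (abs_sub_comm _ _).trans_le (ha' i)

end OUS

/-! ### Comparison of the two distances -/

section Comparison

open Matrix

theorem IsLipNormOUS.abs_sub_le {A : OUS} {LA : A.carrier → ℝ} (h : IsLipNormOUS A LA)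
    (a : A.carrier) {μ ν : A.carrier →ₗ[ℝ] ℝ} (hμ : μ ∈ States A) (hν : ν ∈ States A) :
    |μ a - ν a| ≤ LA a * rhoL A LA μ ν :=
  OUS.abs_sub_le_mul_rhoL h.nonneg h.smul_eq (fun a => (h.null_iff a).1) hμ hν
    (OUS.bddAbove_of_isLipNormOUS h hμ hν) a

theorem lipS_le {A : OUS} {LA : A.carrier → ℝ} (h : IsLipNormOUS A LA) (a : A.carrier) :
    lipS A LA a ≤ LA a :=
  csInf_le ⟨0, fun _ hc => hc.1⟩ ⟨h.nonneg a, fun _ hμ _ hν => h.abs_sub_le a hμ hν⟩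

theorem abs_sub_le_of_lipS_lt {A : OUS} {LA : A.carrier → ℝ} (h : IsLipNormOUS A LA)
    {a : A.carrier} {κ : ℝ} (hκ : lipS A LA a < κ) {μ ν : A.carrier →ₗ[ℝ] ℝ}
    (hμ : μ ∈ States A) (hν : ν ∈ States A) : |μ a - ν a| ≤ κ * rhoL A LA μ ν := by
  have hne : {c : ℝ | 0 ≤ c ∧ ∀ μ ∈ States A, ∀ ν ∈ States A,
      |μ a - ν a| ≤ c * rhoL A LA μ ν}.Nonempty :=
    ⟨LA a, h.nonneg a, fun _ hμ _ hν => h.abs_sub_le a hμ hν⟩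
  obtain ⟨c, ⟨-, hc⟩, hcκ⟩ := exists_lt_of_csInf_lt hne hκ
  exact (hc μ hμ ν hν).trans (mul_le_mul_of_nonneg_right hcκ.le (OUS.rhoL_nonneg μ ν))

section Induces

variable {W V : MOUS} {L : ∀ n : ℕ, Matrix (Fin n) (Fin n) W.carrier → ℝ}
  {LV : ∀ n : ℕ, Matrix (Fin n) (Fin n) V.carrier → ℝ} {f : W.carrier →ₗ[ℂ] V.carrier}

theorem Induces.le (h : Induces W V f L LV) (hL : IsMatrixLipschitzSeminorm W L)
    (w : W.carrier) : LV 1 (oneMat (f w)) ≤ L 1 (oneMat w) := by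
  rw [h 1]
  refine csInf_le ⟨0, ?_⟩ ⟨oneMat w, rfl, rfl⟩
  rintro _ ⟨a, -, rfl⟩
  exact hL.nonneg 1 a

theorem Induces.exists_star_eq_lt (h : Induces W V f L LV) (hL : IsMatrixLipschitzSeminorm W L)
    (hf : Function.Surjective f) (hstar : ∀ w, f (star w) = star (f w)) {v : V.carrier}
    (hv : star v = v) {κ : ℝ} (hκ : LV 1 (oneMat v) < κ) :
    ∃ w, star w = w ∧ f w = v ∧ L 1 (oneMat w) < κ := by
  rw [h 1] at hκ
  obtain ⟨w₀, hw₀⟩ := hf v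
  have hne : {x | ∃ a, mapMat f a = oneMat v ∧ x = L 1 a}.Nonempty :=
    ⟨_, oneMat w₀, by rw [← hw₀]; rfl, rfl⟩
  obtain ⟨_, ⟨a, ha, rfl⟩, haκ⟩ := exists_lt_of_csInf_lt hne hκ
  have hav : f (a 0 0) = v := congrFun (congrFun ha 0) 0
  refine ⟨(2⁻¹ : ℂ) • (a 0 0 + star (a 0 0)), ?_, ?_, ?_⟩
  · rw [star_smul, star_add, star_star, add_comm]
    simp
  · rw [map_smul, map_add, hstar, hav, hv, ← two_smul ℂ v, smul_smul]
    norm_num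
  · have e : oneMat (star (a 0 0)) = (oneMat (a 0 0))ᴴ := rfl
    have h₁ := hL.add_le 1 (oneMat (a 0 0)) (oneMat (a 0 0))ᴴ
    rw [hL.star_eq] at h₁
    rw [oneMat_smul, oneMat_add, e, hL.smul_eq]
    rw [oneMat_apply_zero] at h₁ ⊢
    norm_num
    linarith

end Induces

theorem IsAssociatedQMS.exists_eq_of_star_eq {A : OUS} {LA : A.carrier → ℝ} {V : MOUS}
    {LV : ∀ n : ℕ, Matrix (Fin n) (Fin n) V.carrier → ℝ} {ι : A.carrier → V.carrier}
    (h : IsAssociatedQMS A LA V LV ι) {v : V.carrier} (hv : star v = v) : ∃ a, v = ι a := by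
  obtain ⟨a, b, rfl⟩ := h.spans v
  refine ⟨a, ?_⟩
  rw [star_add, star_smul, h.selfadj, h.selfadj, add_right_inj, Complex.star_def,
    Complex.conj_I, neg_smul, neg_eq_iff_add_eq_zero, ← two_smul ℂ, smul_eq_zero] at hv
  rw [hv.resolve_left two_ne_zero, add_zero]

variable {A₁ A₂ : OUS} {L₁ : A₁.carrier → ℝ} {L₂ : A₂.carrier → ℝ} {V₁ V₂ : MOUS}
  {LV₁ : ∀ n : ℕ, Matrix (Fin n) (Fin n) V₁.carrier → ℝ}
  {LV₂ : ∀ n : ℕ, Matrix (Fin n) (Fin n) V₂.carrier → ℝ}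
  {ι₁ : A₁.carrier → V₁.carrier} {ι₂ : A₂.carrier → V₂.carrier}
  {L : ∀ n : ℕ, Matrix (Fin n) (Fin n) (V₁.prod V₂).carrier → ℝ}

theorem abs_re_sub_le_Dmet_mul (hL : IsMatrixLipNorm (V₁.prod V₂) L) {φ : MState V₁ 1}
    (hφ : φ ∈ CS V₁ 1) {ψ : MState V₂ 1} (hψ : ψ ∈ CS V₂ 1) (v : V₁.carrier) (w : V₂.carrier) :
    |(φ v 0 0).re - (ψ w 0 0).re| ≤
      Dmet (V₁.prod V₂) L 1 (φ.comp (fstL V₁ V₂)) (ψ.comp (sndL V₁ V₂)) *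
        L 1 (oneMat (V := (V₁.prod V₂).carrier) (v, w)) := by
  rw [← Complex.sub_re]
  exact (Complex.abs_re_le_norm _).trans (norm_entry_sub_le_Dmet_mul hL.1
    (totallyBoundedModScalars_of_isMatrixLipNorm hL) (comp_fstL_mem hφ) (comp_sndL_mem hψ)
    (v, w) 0 0)

theorem exists_lipS_lt_of_induces_fstL (ha₁ : IsAssociatedQMS A₁ L₁ V₁ LV₁ ι₁)
    (ha₂ : IsAssociatedQMS A₂ L₂ V₂ LV₂ ι₂) (h₁ : IsLipNormOUS A₁ L₁)
    (hL : L ∈ MSet V₁ LV₁ V₂ LV₂) {a : A₁.carrier} {κ : ℝ} (ha : L₁ a < κ) :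
    ∃ b, lipS A₂ L₂ b < κ ∧ L 1 (oneMat (V := (V₁.prod V₂).carrier) (ι₁ a, ι₂ b)) < κ := by
  obtain ⟨w, hw, hwa, hwκ⟩ := hL.2.1.exists_star_eq_lt hL.1.1 Prod.fst_surjective
    (fun _ => rfl) (ha₁.selfadj a) (((ha₁.lip_eq a).trans_le (lipS_le h₁ a)).trans_lt ha)
  obtain ⟨b, hb⟩ := ha₂.exists_eq_of_star_eq (congrArg Prod.snd hw)
  have e : w = (ι₁ a, ι₂ b) := Prod.ext hwa hb
  rw [e] at hwκ
  exact ⟨b, (ha₂.lip_eq b).symm.trans_lt ((hL.2.2.le hL.1.1 (ι₁ a, ι₂ b)).trans_lt hwκ), hwκ⟩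

theorem exists_lipS_lt_of_induces_sndL (ha₁ : IsAssociatedQMS A₁ L₁ V₁ LV₁ ι₁)
    (ha₂ : IsAssociatedQMS A₂ L₂ V₂ LV₂ ι₂) (h₂ : IsLipNormOUS A₂ L₂)
    (hL : L ∈ MSet V₁ LV₁ V₂ LV₂) {b : A₂.carrier} {κ : ℝ} (hb : L₂ b < κ) :
    ∃ a, lipS A₁ L₁ a < κ ∧ L 1 (oneMat (V := (V₁.prod V₂).carrier) (ι₁ a, ι₂ b)) < κ := by
  obtain ⟨w, hw, hwb, hwκ⟩ := hL.2.2.exists_star_eq_lt hL.1.1 Prod.snd_surjective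
    (fun _ => rfl) (ha₂.selfadj b) (((ha₂.lip_eq b).trans_le (lipS_le h₂ b)).trans_lt hb)
  obtain ⟨a, ha⟩ := ha₁.exists_eq_of_star_eq (congrArg Prod.fst hw)
  have e : w = (ι₁ a, ι₂ b) := Prod.ext ha hwb
  rw [e] at hwκ
  exact ⟨a, (ha₁.lip_eq a).symm.trans_lt ((hL.2.1.le hL.1.1 (ι₁ a, ι₂ b)).trans_lt hwκ), hwκ⟩

theorem bddBelow_distq (A₁ A₂ : OUS) (L₁ : A₁.carrier → ℝ) (L₂ : A₂.carrier → ℝ) :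
    BddBelow {x | ∃ L : (A₁.prod A₂).carrier → ℝ, IsLipNormOUS (A₁.prod A₂) L ∧
      InducesOUS (A₁.prod A₂) A₁ (LinearMap.fst ℝ A₁.carrier A₂.carrier) L L₁ ∧
      InducesOUS (A₁.prod A₂) A₂ (LinearMap.snd ℝ A₁.carrier A₂.carrier) L L₂ ∧
      x = hDist (rhoL (A₁.prod A₂) L)
        ((fun μ : A₁.carrier →ₗ[ℝ] ℝ =>
          μ.comp (LinearMap.fst ℝ A₁.carrier A₂.carrier)) '' States A₁)
        ((fun μ : A₂.carrier →ₗ[ℝ] ℝ =>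
          μ.comp (LinearMap.snd ℝ A₁.carrier A₂.carrier)) '' States A₂)} := by
  refine ⟨0, ?_⟩
  rintro _ ⟨L, -, -, -, rfl⟩
  exact hDist_nonneg OUS.rhoL_nonneg

theorem exists_forall_Dmet_le (hL : IsMatrixLipNorm (V₁.prod V₂) L) :
    ∃ C : ℝ, 0 ≤ C ∧ ∀ n, ∀ x ∈ (fun φ : MState V₁ n => φ.comp (fstL V₁ V₂)) '' CS V₁ n,
      ∀ y ∈ (fun φ : MState V₂ n => φ.comp (sndL V₁ V₂)) '' CS V₂ n,
        Dmet (V₁.prod V₂) L n x y ≤ (n : ℝ) ^ 2 * C := by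
  obtain ⟨C, hC, h⟩ := exists_forall_norm_entry_sub_le
    (totallyBoundedModScalars_of_isMatrixLipNorm hL)
  refine ⟨C, hC, ?_⟩
  rintro n _ ⟨φ, hφ, rfl⟩ _ ⟨ψ, hψ, rfl⟩
  have hφ' := comp_fstL_mem (V₂ := V₂) hφ
  have hψ' := comp_sndL_mem (V₁ := V₁) hψ
  exact Dmet_le hL.1 hφ'.1 hψ'.1 hC (h n _ hφ' _ hψ')

theorem hDist_le_of_forall_le {X : Type} {d : X → X → ℝ} {s t : Set X} {C : ℝ}
    (hd : ∀ x y, 0 ≤ d x y) (hC : 0 ≤ C) (h : ∀ x ∈ s, ∀ y ∈ t, d x y ≤ C) :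
    hDist d s t ≤ C := by
  rcases s.eq_empty_or_nonempty with rfl | ⟨x, hx⟩
  · refine max_le ?_ (Real.sSup_le ?_ hC)
    · simpa using hC
    · rintro _ ⟨y, -, rfl⟩
      simpa using hC
  · rcases t.eq_empty_or_nonempty with rfl | ⟨y, hy⟩
    · refine max_le (Real.sSup_le ?_ hC) ?_
      · rintro _ ⟨y, -, rfl⟩
        simpa using hC
      · simpa using hC
    · exact hDist_le hd hC (fun x hx => ⟨y, hy, h x hx y hy⟩) fun y hy => ⟨x, hx, h x hx y hy⟩

theorem hDist_Dmet_one_le_iSup (hL : IsMatrixLipNorm (V₁.prod V₂) L) :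
    hDist (Dmet (V₁.prod V₂) L 1)
      ((fun φ : MState V₁ 1 => φ.comp (fstL V₁ V₂)) '' CS V₁ 1)
      ((fun φ : MState V₂ 1 => φ.comp (sndL V₁ V₂)) '' CS V₂ 1) ≤
    ⨆ n : ℕ, ((n : ℝ) ^ 2)⁻¹ * hDist (Dmet (V₁.prod V₂) L n)
      ((fun φ : MState V₁ n => φ.comp (fstL V₁ V₂)) '' CS V₁ n)
      ((fun φ : MState V₂ n => φ.comp (sndL V₁ V₂)) '' CS V₂ n) := by
  obtain ⟨C, hC, h⟩ := exists_forall_Dmet_le hL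
  refine le_trans ?_ (le_ciSup ⟨C, ?_⟩ 1)
  · simp
  · rintro _ ⟨n, rfl⟩
    refine (mul_le_mul_of_nonneg_left (hDist_le_of_forall_le Dmet_nonneg (by positivity) (h n))
      (by positivity)).trans ?_
    rw [← mul_assoc]
    exact mul_le_of_le_one_left hC (inv_mul_le_one (a := (n : ℝ) ^ 2))

theorem distq_le_hDist_Dmet_add (h₁ : IsLipNormOUS A₁ L₁) (h₂ : IsLipNormOUS A₂ L₂)
    (ha₁ : IsAssociatedQMS A₁ L₁ V₁ LV₁ ι₁) (ha₂ : IsAssociatedQMS A₂ L₂ V₂ LV₂ ι₂)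
    (hne₁ : (States A₁).Nonempty) (hne₂ : (States A₂).Nonempty)
    (hL : L ∈ MSet V₁ LV₁ V₂ LV₂) {ε : ℝ} (hε : 0 < ε) :
    distq A₁ L₁ A₂ L₂ ≤ hDist (Dmet (V₁.prod V₂) L 1)
      ((fun φ : MState V₁ 1 => φ.comp (fstL V₁ V₂)) '' CS V₁ 1)
      ((fun φ : MState V₂ 1 => φ.comp (sndL V₁ V₂)) '' CS V₂ 1) + (ε + ε) := by
  choose! s₁ hs₁ hs₁' using ha₁.states_to
  choose! s₂ hs₂ hs₂' using ha₂.states_to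
  obtain ⟨C, -, hC⟩ := exists_forall_Dmet_le hL.1
  have hCS₁ : (CS V₁ 1).Nonempty :=
    hne₁.elim fun μ hμ => (ha₁.states_surj μ hμ).imp fun _ h => h.1
  have hCS₂ : (CS V₂ 1).Nonempty :=
    hne₂.elim fun μ hμ => (ha₂.states_surj μ hμ).imp fun _ h => h.1
  let _ : Nonempty (CS V₁ 1 × CS V₂ 1) := ⟨⟨_, hCS₁.some_mem⟩, ⟨_, hCS₂.some_mem⟩⟩
  let μ : CS V₁ 1 × CS V₂ 1 → A₁.carrier →ₗ[ℝ] ℝ := fun i => s₁ i.1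
  let ν : CS V₁ 1 × CS V₂ 1 → A₂.carrier →ₗ[ℝ] ℝ := fun i => s₂ i.2
  let r : CS V₁ 1 × CS V₂ 1 → ℝ := fun i => Dmet (V₁.prod V₂) L 1
    (i.1.1.comp (fstL V₁ V₂)) (i.2.1.comp (sndL V₁ V₂)) + ε
  have hμ : ∀ i, μ i ∈ States A₁ := fun i => hs₁ _ i.1.2
  have hν : ∀ i, ν i ∈ States A₂ := fun i => hs₂ _ i.2.2
  have hr : ∀ i, ε ≤ r i := fun i => le_add_of_nonneg_left (Dmet_nonneg _ _)
  have hμν : ∀ {a b κ}, L 1 (oneMat (V := (V₁.prod V₂).carrier) (ι₁ a, ι₂ b)) < κ →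
      ∀ i, |μ i a - ν i b| ≤ κ * r i := by
    intro a b κ hκ i
    change |s₁ i.1 a - s₂ i.2 b| ≤ _
    rw [hs₁' _ i.1.2, hs₂' _ i.2.2, mul_comm]
    exact (abs_re_sub_le_Dmet_mul hL.1 i.1.2 i.2.2 _ _).trans
      (mul_le_mul (le_add_of_nonneg_right hε.le) hκ.le (hL.1.nonneg _ _) (hε.le.trans (hr i)))
  have hsurj₁ : ∀ μ ∈ States A₁, ∃ φ ∈ CS V₁ 1, s₁ φ = μ := fun μ hμ => by
    obtain ⟨φ, hφ, h⟩ := ha₁.states_surj μ hμ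
    exact ⟨φ, hφ, LinearMap.ext fun a => (hs₁' φ hφ a).trans (h a)⟩
  have hsurj₂ : ∀ μ ∈ States A₂, ∃ φ ∈ CS V₂ 1, s₂ φ = μ := fun μ hμ => by
    obtain ⟨φ, hφ, h⟩ := ha₂.states_surj μ hμ
    exact ⟨φ, hφ, LinearMap.ext fun a => (hs₂' φ hφ a).trans (h a)⟩
  have hrho := OUS.rhoL_glueNorm_le (LA := L₁) (LB := L₂) hμ hν hε hr
  have hH := lt_add_of_pos_right (hDist (Dmet (V₁.prod V₂) L 1)
      ((fun φ : MState V₁ 1 => φ.comp (fstL V₁ V₂)) '' CS V₁ 1)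
      ((fun φ : MState V₂ 1 => φ.comp (sndL V₁ V₂)) '' CS V₂ 1)) hε
  refine (csInf_le (bddBelow_distq _ _ _ _) ⟨OUS.glueNorm L₁ L₂ μ ν r,
    OUS.isLipNormOUS_glueNorm h₁ h₂ hμ hν hε hr,
    OUS.inducesOUS_fst_glueNorm h₁.nonneg hε hr ?_,
    OUS.inducesOUS_snd_glueNorm h₂.nonneg hε hr ?_, rfl⟩).trans
    (hDist_le OUS.rhoL_nonneg (add_nonneg (hDist_nonneg Dmet_nonneg) (by positivity)) ?_ ?_)
  · intro a κ ha
    obtain ⟨κ₀, hκ₀, hκ⟩ := exists_between ha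
    obtain ⟨x, hx, hx'⟩ := exists_lipS_lt_of_induces_fstL ha₁ ha₂ h₁ hL hκ₀
    exact OUS.exists_lt_forall_abs_sub_le_mul hne₂ h₂ hν hε hr ((h₁.nonneg a).trans hκ₀.le) hκ
      (fun _ hω _ hω' => abs_sub_le_of_lipS_lt h₂ hx hω hω') (hμν hx')
  · intro b κ hb
    obtain ⟨κ₀, hκ₀, hκ⟩ := exists_between hb
    obtain ⟨x, hx, hx'⟩ := exists_lipS_lt_of_induces_sndL ha₁ ha₂ h₂ hL hκ₀
    exact OUS.exists_lt_forall_abs_sub_le_mul hne₁ h₁ hμ hε hr ((h₂.nonneg b).trans hκ₀.le) hκ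
      (fun _ hω _ hω' => abs_sub_le_of_lipS_lt h₁ hx hω hω')
      fun i => (abs_sub_comm _ _).trans_le (hμν hx' i)
  · rintro _ ⟨_, hω, rfl⟩
    obtain ⟨φ, hφ, rfl⟩ := hsurj₁ _ hω
    obtain ⟨_, ⟨ψ, hψ, rfl⟩, h⟩ := exists_lt_of_hDist_lt Dmet_nonneg (hC 1) (hCS₂.image _) hH
      (Set.mem_image_of_mem _ hφ)
    refine ⟨_, ⟨_, hs₂ ψ hψ, rfl⟩, (hrho (⟨φ, hφ⟩, ⟨ψ, hψ⟩)).trans ?_⟩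
    rw [← add_assoc]
    exact add_le_add_left h.le ε
  · rintro _ ⟨_, hω, rfl⟩
    obtain ⟨ψ, hψ, rfl⟩ := hsurj₂ _ hω
    rw [← hDist_flip] at hH
    obtain ⟨_, ⟨φ, hφ, rfl⟩, h⟩ := exists_lt_of_hDist_lt (fun x y => Dmet_nonneg y x)
      (fun y hy x hx => hC 1 x hx y hy) (hCS₁.image _) hH (Set.mem_image_of_mem _ hψ)
    rw [hDist_flip] at h
    refine ⟨_, ⟨_, hs₁ φ hφ, rfl⟩, (hrho (⟨φ, hφ⟩, ⟨ψ, hψ⟩)).trans ?_⟩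
    rw [← add_assoc]
    exact add_le_add_left h.le ε

theorem distNC_nonneg : 0 ≤ distNC V₁ LV₁ V₂ LV₂ := by
  refine Real.sInf_nonneg ?_
  rintro _ ⟨L, -, rfl⟩
  exact Real.iSup_nonneg fun n => mul_nonneg (by positivity) (hDist_nonneg Dmet_nonneg)

theorem distq_nonpos_of_states_eq_empty (h : States A₁ = ∅ ∨ States A₂ = ∅) :
    distq A₁ L₁ A₂ L₂ ≤ 0 := by
  refine Real.sInf_nonpos ?_
  rintro _ ⟨L, -, -, -, rfl⟩
  refine hDist_le_of_forall_le OUS.rhoL_nonneg le_rfl ?_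
  rintro _ ⟨μ, hμ, rfl⟩ _ ⟨ν, hν, rfl⟩
  rcases h with h | h
  · exact absurd hμ (h ▸ Set.notMem_empty μ)
  · exact absurd hν (h ▸ Set.notMem_empty ν)

end Comparison

/-- Proposition 4.9 of the paper.  Let `(A_j, L_j)` (`j = 1, 2`) be
compact quantum metric spaces and let `(V_j, 𝓛_j)` be an associated quantized metric
space of `(A_j, L_j)`.  Then `dist_q(A₁, A₂) ≤ dist_NC(V₁, V₂)`, where `dist_q` is
Rieffel's quantum Gromov–Hausdorff distance. -/
theorem distq_le_distNC (A₁ A₂ : OUS)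
    (L₁ : A₁.carrier → ℝ) (L₂ : A₂.carrier → ℝ)
    (h₁ : IsLipNormOUS A₁ L₁) (h₂ : IsLipNormOUS A₂ L₂)
    (V₁ V₂ : MOUS)
    (LV₁ : ∀ n : ℕ, Matrix (Fin n) (Fin n) V₁.carrier → ℝ)
    (LV₂ : ∀ n : ℕ, Matrix (Fin n) (Fin n) V₂.carrier → ℝ)
    (ι₁ : A₁.carrier → V₁.carrier) (ι₂ : A₂.carrier → V₂.carrier)
    (ha₁ : IsAssociatedQMS A₁ L₁ V₁ LV₁ ι₁)
    (ha₂ : IsAssociatedQMS A₂ L₂ V₂ LV₂ ι₂) :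
    distq A₁ L₁ A₂ L₂ ≤ distNC V₁ LV₁ V₂ LV₂ := by
  rcases (States A₁).eq_empty_or_nonempty with hne₁ | hne₁
  · exact (distq_nonpos_of_states_eq_empty (.inl hne₁)).trans distNC_nonneg
  rcases (States A₂).eq_empty_or_nonempty with hne₂ | hne₂
  · exact (distq_nonpos_of_states_eq_empty (.inr hne₂)).trans distNC_nonneg
  obtain ⟨L, hL⟩ := MSet_nonempty ha₁.lip ha₂.lip
    (hne₁.elim fun μ hμ => (ha₁.states_surj μ hμ).imp fun _ h => h.1)
    (hne₂.elim fun μ hμ => (ha₂.states_surj μ hμ).imp fun _ h => h.1)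
  refine le_csInf ⟨_, L, hL, rfl⟩ ?_
  rintro _ ⟨L, hL, rfl⟩
  refine le_of_forall_pos_le_add fun ε hε => ?_
  have h := distq_le_hDist_Dmet_add h₁ h₂ ha₁ ha₂ hne₁ hne₂ hL (half_pos hε)
  rw [add_halves] at h
  exact h.trans (by gcongr; exact hDist_Dmet_one_le_iSup hL.1)

end
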